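/- arXiv:2002.08894 — 6 statements merged into one kernel-verified Lean document; each statement's English description precedes it below -/
import Mathlib

section
/- For any weakly exact pointwise finite-dimensional persistence module M over a finite grid X × Y, there exists a unique multiset 𝓡 of rectangles of X × Y such that M is isomorphic to the direct sum over R ∈ 𝓡 of the rectangle modules k_R. -/
open CategoryTheory Limits Set

noncomputable section

set_option linter.unusedSectionVars false

attribute [local instance] Classical.propDecidable

namespace PersistencePaper

/-- A persistence module over a poset `P`, with coefficients in a field `k`:
a functor from `P` (viewed as a category) to the category of `k`-vector spaces. -/
abbrev PersistenceModule (k : Type) [Field k] (P : Type) [Preorder P] : Type 1 :=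
  P ⥤ ModuleCat k

variable (k : Type) [Field k]

section Indicator

variable {P : Type} [Preorder P]

/-- The fiber of the indicator module of a set `Q ⊆ P` at a point `t : P`,
realized as a submodule of `k`: it is all of `k` when `t ∈ Q` and `0` otherwise. -/
def indSub (Q : Set P) (t : P) : Submodule k k where
  carrier := {x | t ∉ Q → x = 0}
  add_mem' := by intro a b ha hb ht; rw [ha ht, hb ht, add_zero]
  zero_mem' := fun _ => rfl
  smul_mem' := by intro c x hx ht; rw [hx ht, smul_zero]

/-- The structure map of the indicator module: the identity when both endpoints lie in
`Q`, and zero otherwise. -/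
def indMap (Q : Set P) (s t : P) : indSub k Q s →ₗ[k] indSub k Q t where
  toFun x := ⟨if s ∈ Q ∧ t ∈ Q then (x : k) else 0, by
    intro ht
    split_ifs with h
    · exact absurd h.2 ht
    · rfl⟩
  map_add' x y := by apply Subtype.ext; split_ifs <;> simp
  map_smul' c x := by apply Subtype.ext; split_ifs <;> simp

theorem indMap_coe (Q : Set P) (s t : P) (x : indSub k Q s) :
    (indMap k Q s t x : k) = if s ∈ Q ∧ t ∈ Q then (x : k) else 0 := rfl

/-- The indicator persistence module `k_Q` of a convex subset `Q` of a poset `P`: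
it assigns `k` to points of `Q` and `0` elsewhere, the structure maps being the identity
between points of `Q` and zero otherwise. -/
def indicator (Q : Set P) (hQ : Q.OrdConnected) : PersistenceModule k P where
  obj t := ModuleCat.of k (indSub k Q t)
  map {s t} _ := ModuleCat.ofHom (indMap k Q s t)
  map_id t := by
    refine ModuleCat.hom_ext <| LinearMap.ext fun x => Subtype.ext ?_
    show (indMap k Q t t x).val = Subtype.val x
    rw [indMap_coe]
    split_ifs with h
    · rfl
    · exact (x.2 fun ht => h ⟨ht, ht⟩).symm
  map_comp {s t u} f g := by
    refine ModuleCat.hom_ext <| LinearMap.ext fun x => Subtype.ext ?_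
    show (indMap k Q s u x).val = (indMap k Q t u (indMap k Q s t x)).val
    rw [indMap_coe, indMap_coe, indMap_coe]
    by_cases hs : s ∈ Q <;> by_cases hu : u ∈ Q
    · have ht : t ∈ Q := hQ.out hs hu ⟨leOfHom f, leOfHom g⟩
      simp [hs, ht, hu]
    · simp [hs, hu]
    · simp [hs, hu]
    · simp [hs, hu]

/-- The structure map `ρ_s^t : M_s → M_t` of a persistence module, as a linear map. -/
def rho (M : PersistenceModule k P) {s t : P} (h : s ≤ t) : M.obj s →ₗ[k] M.obj t :=
  (M.map (homOfLE h)).hom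

/-- The rank invariant `r(s,t)` of a persistence module: the rank of `ρ_s^t` when `s ≤ t`,
and `0` (by convention) otherwise. -/
def rk (M : PersistenceModule k P) (s t : P) : ℕ :=
  if h : s ≤ t then Module.finrank k (LinearMap.range (rho k M h)) else 0

/-- A persistence module is pointwise finite-dimensional (pfd) if all its spaces are
finite-dimensional. -/
def Pfd (M : PersistenceModule k P) : Prop :=
  ∀ t : P, FiniteDimensional k (M.obj t)

/-- An interval of a poset: a nonempty, convex and zigzag-connected subset. -/
def IsInterval (Q : Set P) : Prop :=
  Q.Nonempty ∧ Q.OrdConnected ∧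
    ∀ p ∈ Q, ∀ q ∈ Q,
      Relation.ReflTransGen (fun a b => a ∈ Q ∧ b ∈ Q ∧ (a ≤ b ∨ b ≤ a)) p q

/-- A persistence module is interval-decomposable if it is isomorphic to a direct sum
of indicator modules of intervals. -/
def IntervalDecomposable (M : PersistenceModule k P) : Prop :=
  ∃ (ι : Type) (I : ι → Set P) (hI : ∀ i, IsInterval (I i)),
    Nonempty (M ≅ ∐ fun i => indicator k (I i) (hI i).2.1)

end Indicator

section Rect

variable {X Y : Type} [Preorder X] [Preorder Y]

/-- A rectangle in the product poset `X × Y`: a nonempty product `I ×ˢ J` of an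
interval (convex subset) of `X` with an interval of `Y`. -/
def IsRectangle (R : Set (X × Y)) : Prop :=
  R.Nonempty ∧ ∃ (I : Set X) (J : Set Y), I.OrdConnected ∧ J.OrdConnected ∧ R = I ×ˢ J

theorem IsRectangle.ordConnected {R : Set (X × Y)} (h : IsRectangle R) :
    R.OrdConnected := by
  obtain ⟨-, I, J, hI, hJ, rfl⟩ := h
  constructor
  intro x hx y hy z hz
  exact ⟨hI.out hx.1 hy.1 ⟨hz.1.1, hz.2.1⟩, hJ.out hx.2 hy.2 ⟨hz.1.2, hz.2.2⟩⟩

/-- A persistence bimodule is rectangle-decomposable if it is isomorphic to a direct sum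
of indicator (rectangle) modules of rectangles. -/
def RectangleDecomposable (M : PersistenceModule k (X × Y)) : Prop :=
  ∃ (ι : Type) (R : ι → Set (X × Y)) (hR : ∀ i, IsRectangle (R i)),
    Nonempty (M ≅ ∐ fun i => indicator k (R i) (hR i).ordConnected)

/-- A persistence bimodule `M` over `X × Y` is weakly exact if for all `s ≤ t`,
`Im ρ_s^t = Im ρ_{(t₁,s₂)}^t ∩ Im ρ_{(s₁,t₂)}^t` and
`Ker ρ_s^t = Ker ρ_s^{(t₁,s₂)} + Ker ρ_s^{(s₁,t₂)}`. -/
def WeaklyExact (M : PersistenceModule k (X × Y)) : Prop :=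
  ∀ (s t : X × Y) (h : s ≤ t),
    (LinearMap.range (rho k M h) =
        LinearMap.range (rho k M (show (t.1, s.2) ≤ t from ⟨le_refl t.1, h.2⟩)) ⊓
        LinearMap.range (rho k M (show (s.1, t.2) ≤ t from ⟨h.1, le_refl t.2⟩))) ∧
    (LinearMap.ker (rho k M h) =
        LinearMap.ker (rho k M (show s ≤ (t.1, s.2) from ⟨h.1, le_refl s.2⟩)) ⊔
        LinearMap.ker (rho k M (show s ≤ (s.1, t.2) from ⟨le_refl s.1, h.2⟩)))

/-- The space (fiber) of a persistence module at an index. -/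
abbrev fiber {k : Type} [Field k] {P : Type} [Preorder P]
    (M : PersistenceModule k P) (t : P) : ModuleCat k :=
  M.obj t

/-- Morphisms of persistence modules (natural transformations). -/
abbrev PMHom {k : Type} [Field k] {P : Type} [Preorder P]
    (M N : PersistenceModule k P) : Type :=
  M ⟶ N

/-- The component of a morphism of persistence modules at an index, as a linear map. -/
abbrev PMHom.appLin {k : Type} [Field k] {P : Type} [Preorder P]
    {M N : PersistenceModule k P} (f : PMHom M N) (t : P) :
    M.obj t →ₗ[k] N.obj t :=
  (f.app t).hom

/-- The restriction of a persistence module to a subset of its indexing poset. -/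
def restrict {P : Type} [Preorder P] (M : PersistenceModule k P) (S : Set P) :
    PersistenceModule k ↥S :=
  (show Monotone (Subtype.val : ↥S → P) from fun _ _ h => h).functor ⋙ M

/-- The pullback (restriction) of a persistence module along a monotone map of posets. -/
def restrictAlong {P R : Type} [Preorder P] [Preorder R] {f : R → P} (hf : Monotone f)
    (M : PersistenceModule k P) : PersistenceModule k R :=
  hf.functor ⋙ M

/-- The right Kan extension of a persistence module along a monotone map of posets. -/
def ranAlong {P R : Type} [Preorder P] [Preorder R] {f : P → R} (hf : Monotone f)
    (M : PersistenceModule k P) : PersistenceModule k R :=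
  hf.functor.ran.obj M

/-- `M` decomposes as a direct sum of indicator modules whose supports are drawn from
the family `A` of (convex) subsets of the indexing poset. -/
def DecomposesWithSupports {P : Type} [Preorder P] (M : PersistenceModule k P)
    (A : Set (Set P)) : Prop :=
  ∃ (ι : Type) (Q : ι → Set P) (_ : ∀ i, Q i ∈ A) (hconv : ∀ i, (Q i).OrdConnected),
    Nonempty (M ≅ ∐ fun i => indicator k (Q i) (hconv i))

end Rect

end PersistencePaper
namespace PersistencePaper


section Helpers

variable {k : Type} [Field k]

section General

variable {P : Type} [Preorder P] {M N : PersistenceModule k P}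

theorem rho_rho {s t u : P} (h1 : s ≤ t) (h2 : t ≤ u) (x : M.obj s) :
    rho k M h2 (rho k M h1 x) = rho k M (h1.trans h2) x := by
  have : M.map (homOfLE (h1.trans h2)) = M.map (homOfLE h1) ≫ M.map (homOfLE h2) := by
    rw [← M.map_comp]; rfl
  exact (congrArg (fun q => q.hom x) this).symm

theorem rho_refl {s : P} (h : s ≤ s) (x : M.obj s) : rho k M h x = x := by
  have : M.map (homOfLE h) = 𝟙 _ := by
    rw [← M.map_id]; rfl
  exact congrArg (fun q => q.hom x) this

/-- Component of a morphism. -/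
def ap (f : M ⟶ N) (t : P) : M.obj t →ₗ[k] N.obj t := (f.app t).hom

theorem ap_rho (f : M ⟶ N) {s t : P} (h : s ≤ t) (x : M.obj s) :
    ap f t (rho k M h x) = rho k N h (ap f s x) :=
  congrArg (fun q => q.hom x) (f.naturality (homOfLE h))

theorem pm_ext {f g : M ⟶ N} (h : ∀ t x, ap f t x = ap g t x) : f = g :=
  NatTrans.ext <| funext fun t => ModuleCat.hom_ext <| LinearMap.ext fun x => h t x

theorem ap_id (t : P) (x : M.obj t) : ap (𝟙 M) t x = x := rfl

theorem ap_zero (t : P) (x : M.obj t) : ap (0 : M ⟶ N) t x = 0 := rfl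

theorem ap_comp {L : PersistenceModule k P} (f : M ⟶ N) (g : N ⟶ L) (t : P) (x : M.obj t) :
    ap (f ≫ g) t x = ap g t (ap f t x) := rfl

theorem ap_sum {ι : Type} [Fintype ι] (f : ι → (M ⟶ N)) (t : P) (x : M.obj t) :
    ap (∑ i, f i) t x = ∑ i, ap (f i) t x := by
  simp [ap, NatTrans.app_sum, ModuleCat.hom_sum]

theorem ap_comp_id {f : M ⟶ N} {g : N ⟶ M} (h : f ≫ g = 𝟙 M) (t : P) (x : M.obj t) :
    ap g t (ap f t x) = x := by
  rw [← ap_comp, h, ap_id]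

section Ind

variable {R : Set P} {hR : R.OrdConnected}

/-- Value in `k` of an element of an indicator module. -/
def ival {t : P} : (indicator k R hR).obj t →ₗ[k] k := (indSub k R t).subtype

theorem ival_inj {t : P} {x y : (indicator k R hR).obj t} (h : ival x = ival y) : x = y :=
  Subtype.ext h

theorem ival_zero {t : P} (ht : t ∉ R) (x : (indicator k R hR).obj t) : ival x = 0 :=
  Subtype.prop (show indSub k R t from x) ht

theorem ival_rho {s t : P} (h : s ≤ t) (x : (indicator k R hR).obj s) :
    ival (rho k (indicator k R hR) h x) = if s ∈ R ∧ t ∈ R then ival x else 0 := rfl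

/-- The generator. -/
def ione (hR : R.OrdConnected) {t : P} (ht : t ∈ R) : (indicator k R hR).obj t :=
  show indSub k R t from ⟨1, fun hn => absurd ht hn⟩

theorem ival_ione {t : P} (ht : t ∈ R) : ival (ione (k := k) hR ht) = 1 := rfl

end Ind

/-- Morphism out of an indicator module given by an element. -/
theorem exists_homFrom (R : Set P) (hR : R.OrdConnected) (s₀ : P) (m : M.obj s₀)
    (h1 : ∀ t ∈ R, s₀ ≤ t) (h2 : ∀ t (h : s₀ ≤ t), t ∉ R → rho k M h m = 0) :
    ∃ f : indicator k R hR ⟶ M, ∀ t (h : s₀ ≤ t) (x : (indicator k R hR).obj t),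
      ap f t x = ival x • rho k M h m := by
  let F : ∀ t, (indicator k R hR).obj t →ₗ[k] M.obj t := fun t =>
    if h : s₀ ≤ t then (LinearMap.toSpanSingleton k _ (rho k M h m)) ∘ₗ ival
    else 0
  have hF : ∀ t (h : s₀ ≤ t) (x : (indicator k R hR).obj t), F t x = ival x • rho k M h m := by
    intro t h x
    simp only [F, dif_pos h]
    rfl
  refine ⟨{ app := fun t => ModuleCat.ofHom (F t), naturality := ?_ }, hF⟩
  intro s t hst
  refine ModuleCat.hom_ext <| LinearMap.ext fun x => ?_
  change F t (rho k _ (leOfHom hst) x) = rho k M (leOfHom hst) (F s x)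
  by_cases hs : s ∈ R
  · rw [hF s (h1 s hs), hF t ((h1 s hs).trans (leOfHom hst)), ival_rho, map_smul, rho_rho]
    by_cases ht : t ∈ R
    · simp [hs, ht]
    · rw [h2 t _ ht]; simp
  · have : x = 0 := ival_inj (by rw [ival_zero hs, map_zero])
    rw [this]; simp only [map_zero]

/-- Morphism into an indicator module given by a functional. -/
theorem exists_homTo (R : Set P) (hR : R.OrdConnected) (t₀ : P) (φ : M.obj t₀ →ₗ[k] k)
    (h1 : ∀ t ∈ R, t ≤ t₀)
    (h2 : ∀ s t (h : s ≤ t₀), s ∉ R → t ∈ R → s ≤ t → ∀ x, φ (rho k M h x) = 0) :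
    ∃ g : M ⟶ indicator k R hR, ∀ t (ht : t ∈ R) (x : M.obj t),
      ival (ap g t x) = φ (rho k M (h1 t ht) x) := by
  let G : ∀ t, M.obj t →ₗ[k] (indicator k R hR).obj t := fun t =>
    if h : t ∈ R then
      (φ ∘ₗ rho k M (h1 t h)).codRestrict (indSub k R t) (fun _ hn => absurd h hn)
    else 0
  have hG : ∀ t (ht : t ∈ R) (x : M.obj t), ival (G t x) = φ (rho k M (h1 t ht) x) := by
    intro t h x
    have : G t = (φ ∘ₗ rho k M (h1 t h)).codRestrict (indSub k R t) (fun _ hn => absurd h hn) :=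
      dif_pos h
    rw [this]
    rfl
  refine ⟨{ app := fun t => ModuleCat.ofHom (G t), naturality := ?_ }, hG⟩
  intro s t hst
  refine ModuleCat.hom_ext <| LinearMap.ext fun x => ival_inj ?_
  change ival (G t (rho k M (leOfHom hst) x)) = ival (rho k _ (leOfHom hst) (G s x))
  rw [ival_rho]
  by_cases ht : t ∈ R
  · rw [hG t ht, rho_rho]
    by_cases hs : s ∈ R
    · simp [hs, ht, hG s hs]
    · simp [hs, h2 s t ((leOfHom hst).trans (h1 t ht)) hs ht (leOfHom hst)]
  · rw [ival_zero ht]; simp [ht]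

/-- Elementwise finite decomposition data. -/
def Dec (M : PersistenceModule k P) {ι : Type} [Fintype ι] (R : ι → Set P)
    (hR : ∀ i, (R i).OrdConnected) : Prop :=
  ∃ (f : ∀ i, indicator k (R i) (hR i) ⟶ M) (g : ∀ i, M ⟶ indicator k (R i) (hR i)),
    (∀ i, f i ≫ g i = 𝟙 _) ∧ (∀ i j, i ≠ j → f i ≫ g j = 0) ∧ ∑ i, g i ≫ f i = 𝟙 M

theorem Dec.iso {ι : Type} [Fintype ι] {R : ι → Set P}
    {hR : ∀ i, (R i).OrdConnected} (h : Dec M R hR) :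
    Nonempty (M ≅ ∐ fun i => indicator k (R i) (hR i)) := by
  obtain ⟨f, g, h1, h2, h3⟩ := h
  refine ⟨⟨∑ i, g i ≫ Sigma.ι (fun i => indicator k (R i) (hR i)) i, Sigma.desc f, ?_, ?_⟩⟩
  · rw [Preadditive.sum_comp, ← h3]
    simp
  · refine Sigma.hom_ext _ _ fun i => ?_
    rw [colimit.ι_desc_assoc, Cofan.mk_ι_app, Preadditive.comp_sum, Finset.sum_eq_single i]
    · rw [← Category.assoc, h1]; simp
    · intro j _ hj
      rw [← Category.assoc, h2 i j hj.symm]; simp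
    · simp

theorem Dec.of_iso {ι : Type} [Fintype ι] {R : ι → Set P}
    {hR : ∀ i, (R i).OrdConnected}
    (h : Nonempty (M ≅ ∐ fun i => indicator k (R i) (hR i))) : Dec M R hR := by
  obtain ⟨e⟩ := h
  let d : ∀ i j, indicator k (R i) (hR i) ⟶ indicator k (R j) (hR j) := fun i j =>
    if h : i = j then eqToHom (by subst h; rfl) else 0
  have d1 : ∀ i, d i i = 𝟙 _ := fun i => by simp [d]
  have d2 : ∀ i j, i ≠ j → d i j = 0 := fun i j h => by simp [d, h]
  refine ⟨fun i => Sigma.ι (fun i => indicator k (R i) (hR i)) i ≫ e.inv,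
    fun j => e.hom ≫ Sigma.desc (fun i => d i j), ?_, ?_, ?_⟩
  · intro i; simp [d1]
  · intro i j hij; simp [d2 i j hij]
  · rw [← cancel_epi e.inv, ← cancel_mono e.hom]
    refine Sigma.hom_ext _ _ fun i => ?_
    simp only [Preadditive.comp_sum, Preadditive.sum_comp, Category.assoc, Iso.inv_hom_id_assoc,
      Iso.inv_hom_id, Category.comp_id, colimit.ι_desc_assoc, Cofan.mk_ι_app]
    rw [Finset.sum_eq_single i]
    · simp [d1]
    · intro j _ hj
      simp [d2 i j hj.symm]
    · simp

theorem Dec.finrank {ι : Type} [Fintype ι] {R : ι → Set P}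
    {hR : ∀ i, (R i).OrdConnected} (h : Dec M R hR) {s t : P} (hst : s ≤ t) :
    Module.finrank k (LinearMap.range (rho k M hst)) =
      Fintype.card {i : ι // s ∈ R i ∧ t ∈ R i} := by
  obtain ⟨f, g, h1, h2, h3⟩ := h
  let b : {i : ι // s ∈ R i ∧ t ∈ R i} → M.obj t := fun i => ap (f i.1) t (ione (hR i.1) i.2.2)
  have hb : ∀ i, b i = rho k M hst (ap (f i.1) s (ione (hR i.1) i.2.1)) := by
    intro i
    rw [← ap_rho]
    refine congrArg (ap (f i.1) t) (ival_inj ?_)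
    rw [ival_rho, ival_ione, ival_ione, if_pos i.2]
  have hli : LinearIndependent k b := by
    rw [Fintype.linearIndependent_iff]
    intro c hc i
    have := congrArg (ap (g i.1) t) hc
    rw [map_sum, map_zero, Finset.sum_eq_single i] at this
    · rw [map_smul, ap_comp_id (h1 i.1)] at this
      have h5 := congrArg ival this
      rw [map_smul, ival_ione, map_zero] at h5
      simpa using h5
    · intro j _ hj
      rw [map_smul, ← ap_comp, h2 j.1 i.1 (fun h => hj (Subtype.ext h)), ap_zero, smul_zero]
    · simp
  have hspan : LinearMap.range (rho k M hst) = Submodule.span k (Set.range b) := by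
    apply le_antisymm
    · rintro _ ⟨m, rfl⟩
      have h8 : m = ∑ i, ap (f i) s (ap (g i) s m) := by
        have h9 := ap_sum (fun i => g i ≫ f i) s m
        rw [h3, ap_id] at h9
        exact h9
      rw [h8, map_sum]
      refine Submodule.sum_mem _ fun i _ => ?_
      rw [← ap_rho]
      by_cases hi : s ∈ R i ∧ t ∈ R i
      · have : rho k _ hst (ap (g i) s m) = ival (ap (g i) s m) • ione (hR i) hi.2 := by
          apply ival_inj
          rw [ival_rho, if_pos hi, map_smul, ival_ione]
          simp
        rw [this, map_smul]
        exact Submodule.smul_mem _ _ (Submodule.subset_span ⟨⟨i, hi⟩, rfl⟩)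
      · have : rho k _ hst (ap (g i) s m) = 0 := by
          apply ival_inj
          rw [ival_rho, if_neg hi, map_zero]
        rw [this, map_zero]
        exact Submodule.zero_mem _
    · rw [Submodule.span_le]
      rintro _ ⟨i, rfl⟩
      rw [hb]
      exact ⟨_, rfl⟩
  rw [← finrank_span_eq_card hli, hspan]

theorem Dec.reindex {ι κ : Type} [Fintype ι] [Fintype κ] {R : ι → Set P}
    {hR : ∀ i, (R i).OrdConnected} (h : Dec M R hR) (e : κ ≃ ι) (R' : κ → Set P)
    (hR' : ∀ i, (R' i).OrdConnected) (he : ∀ i, R' i = R (e i)) : Dec M R' hR' := by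
  obtain rfl : R' = fun i => R (e i) := funext he
  obtain ⟨f, g, h1, h2, h3⟩ := h
  refine ⟨fun i => f (e i), fun i => g (e i), fun i => h1 _,
    fun i j hij => h2 _ _ (fun h => hij (e.injective h)), ?_⟩
  rw [← h3]
  exact Equiv.sum_comp e (fun i => g i ≫ f i)

theorem dec_split {C : PersistenceModule k P} {S : Set P} (hS : S.OrdConnected)
    (f : indicator k S hS ⟶ M) (g : M ⟶ indicator k S hS) (i : C ⟶ M) (p : M ⟶ C)
    (hfg : f ≫ g = 𝟙 _) (hip : i ≫ p = 𝟙 _) (hig : i ≫ g = 0) (hfp : f ≫ p = 0)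
    (htot : g ≫ f + p ≫ i = 𝟙 M) {ι : Type} [Fintype ι] {R : ι → Set P}
    {hR : ∀ i, (R i).OrdConnected} (h : Dec C R hR) :
    Dec M (fun o : Option ι => o.elim S R) (fun o => by cases o; exacts [hS, hR _]) := by
  obtain ⟨F, G, h1, h2, h3⟩ := h
  refine ⟨fun o => match o with
      | none => f
      | some j => F j ≫ i, fun o => match o with
      | none => g
      | some j => p ≫ G j, ?_, ?_, ?_⟩
  · rintro (_ | j)
    · exact hfg
    · change (F j ≫ i) ≫ p ≫ G j = _
      rw [Category.assoc, reassoc_of% hip]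
      exact h1 j
  · rintro (_ | j) (_ | l) hne
    · exact absurd rfl hne
    · change f ≫ p ≫ G l = 0
      rw [reassoc_of% hfp, zero_comp]
    · change (F j ≫ i) ≫ g = 0
      rw [Category.assoc, hig, comp_zero]
    · change (F j ≫ i) ≫ p ≫ G l = 0
      rw [Category.assoc, reassoc_of% hip]
      exact h2 j l (fun h => hne (by rw [h]))
  · rw [Fintype.sum_option]
    change g ≫ f + ∑ j, (p ≫ G j) ≫ F j ≫ i = _
    rw [← htot]
    congr 1
    have : p ≫ (∑ j, G j ≫ F j) ≫ i = p ≫ i := by rw [h3, Category.id_comp]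
    rw [← this, Preadditive.sum_comp, Preadditive.comp_sum]
    simp

theorem pfd_retract {C : PersistenceModule k P} (i : C ⟶ M) (p : M ⟶ C) (hip : i ≫ p = 𝟙 _)
    (hM : Pfd k M) : Pfd k C := by
  intro t
  have := hM t
  exact Module.Finite.of_surjective (ap p t) (fun x => ⟨_, ap_comp_id hip t x⟩)

end General

section Grid

variable {X Y : Type} [LinearOrder X] [LinearOrder Y] {M : PersistenceModule k (X × Y)}

theorem we_retract {C : PersistenceModule k (X × Y)} (i : C ⟶ M) (p : M ⟶ C)
    (hip : i ≫ p = 𝟙 _) (hM : WeaklyExact k M) : WeaklyExact k C := by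
  intro s t h
  obtain ⟨h1, h2⟩ := hM s t h
  constructor
  · apply le_antisymm
    · rintro _ ⟨x, rfl⟩
      exact ⟨⟨rho k C (show s ≤ (t.1, s.2) from ⟨h.1, le_refl s.2⟩) x, rho_rho _ _ _⟩,
        ⟨rho k C (show s ≤ (s.1, t.2) from ⟨le_refl s.1, h.2⟩) x, rho_rho _ _ _⟩⟩
    · rintro x ⟨⟨u, hu⟩, ⟨v, hv⟩⟩
      have : ap i t x ∈ LinearMap.range (rho k M h) := by
        rw [h1]
        refine ⟨⟨ap i _ u, ?_⟩, ⟨ap i _ v, ?_⟩⟩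
        · rw [← ap_rho, hu]
        · rw [← ap_rho, hv]
      obtain ⟨z, hz⟩ := this
      refine ⟨ap p s z, ?_⟩
      rw [← ap_rho, hz, ap_comp_id hip]
  · apply le_antisymm
    · intro x hx
      have : ap i s x ∈ LinearMap.ker (rho k M h) := by
        rw [LinearMap.mem_ker] at hx ⊢
        rw [← ap_rho, hx, map_zero]
      rw [h2, Submodule.mem_sup] at this
      obtain ⟨u, hu, v, hv, huv⟩ := this
      rw [LinearMap.mem_ker] at hu hv
      rw [Submodule.mem_sup]
      refine ⟨ap p s u, ?_, ap p s v, ?_, ?_⟩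
      · rw [LinearMap.mem_ker, ← ap_rho, hu, map_zero]
      · rw [LinearMap.mem_ker, ← ap_rho, hv, map_zero]
      · rw [← map_add, huv, ap_comp_id hip]
    · refine sup_le ?_ ?_
      · intro x hx
        rw [LinearMap.mem_ker] at hx ⊢
        rw [← rho_rho (show s ≤ (t.1, s.2) from ⟨h.1, le_refl s.2⟩) (show (t.1, s.2) ≤ t from ⟨le_refl _, h.2⟩), hx, map_zero]
      · intro x hx
        rw [LinearMap.mem_ker] at hx ⊢
        rw [← rho_rho (show s ≤ (s.1, t.2) from ⟨le_refl s.1, h.2⟩) (show (s.1, t.2) ≤ t from ⟨h.1, le_refl _⟩), hx, map_zero]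

theorem exists_min_on {Z : Type} [LinearOrder Z] [Finite Z] {p : Z → Prop} (h : ∃ z, p z) :
    ∃ z, p z ∧ ∀ w, w < z → ¬ p w := by
  obtain ⟨z, hz, hm⟩ := (wellFounded_lt (α := Z)).has_min {z | p z} h
  exact ⟨z, hz, fun w hw hp => hm w hp hw⟩

theorem exists_max_on {Z : Type} [LinearOrder Z] [Finite Z] {p : Z → Prop} (h : ∃ z, p z) :
    ∃ z, p z ∧ ∀ w, p w → w ≤ z := by
  obtain ⟨z, hz, hm⟩ := (wellFounded_gt (α := Z)).has_min {z | p z} h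
  exact ⟨z, hz, fun w hw => not_lt.1 (hm w hw)⟩

theorem exists_summand [Finite X] [Finite Y] (hwe : WeaklyExact k M)
    (hne : ∃ t, Nontrivial (fiber M t)) :
    ∃ (R : Set (X × Y)) (hR : IsRectangle R) (f : indicator k R hR.ordConnected ⟶ M)
      (g : M ⟶ indicator k R hR.ordConnected), f ≫ g = 𝟙 _ := by
  obtain ⟨⟨x0, y0⟩, h0⟩ := hne
  obtain ⟨a, ⟨y1, h1⟩, ha⟩ := exists_min_on (p := fun x => ∃ y, Nontrivial (fiber M (x, y)))
    ⟨x0, y0, h0⟩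
  obtain ⟨c, hc0, hc⟩ := exists_min_on (p := fun y => Nontrivial (fiber M (a, y))) ⟨y1, h1⟩
  have ha' : ∀ x y, x < a → Subsingleton (fiber M (x, y)) := fun x y hx =>
    not_nontrivial_iff_subsingleton.1 fun h => ha x hx ⟨y, h⟩
  have hc' : ∀ y, y < c → Subsingleton (fiber M (a, y)) := fun y hy =>
    not_nontrivial_iff_subsingleton.1 (hc y hy)
  clear ha hc h1 h0
  let I : fiber M (a, c) → Set X := fun m =>
    {x | ∃ h : a ≤ x, rho k M (show (a, c) ≤ (x, c) from ⟨h, le_rfl⟩) m ≠ 0}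
  let J : fiber M (a, c) → Set Y := fun m =>
    {y | ∃ h : c ≤ y, rho k M (show (a, c) ≤ (a, y) from ⟨le_rfl, h⟩) m ≠ 0}
  have hI : ∀ m x x', x ∈ I m → a ≤ x' → x' ≤ x → x' ∈ I m := by
    rintro m x x' ⟨h, hx⟩ hax hxx
    refine ⟨hax, fun h0 => hx ?_⟩
    rw [← rho_rho (show (a, c) ≤ (x', c) from ⟨hax, le_rfl⟩) (show (x', c) ≤ (x, c) from ⟨hxx, le_rfl⟩), h0, map_zero]
  have hJ : ∀ m x x', x ∈ J m → c ≤ x' → x' ≤ x → x' ∈ J m := by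
    rintro m x x' ⟨h, hx⟩ hax hxx
    refine ⟨hax, fun h0 => hx ?_⟩
    rw [← rho_rho (show (a, c) ≤ (a, x') from ⟨le_rfl, hax⟩) (show (a, x') ≤ (a, x) from ⟨le_rfl, hxx⟩), h0, map_zero]
  obtain ⟨m, hm0, hmin⟩ := (InvImage.wf (fun m => (I m).ncard) (wellFounded_lt (α := ℕ))).has_min
    {m | m ≠ 0} (exists_ne 0)
  have hmin' : ∀ m', m' ≠ 0 → (I m).ncard ≤ (I m').ncard := fun m' h =>
    not_lt.1 (hmin m' h)
  have haI : a ∈ I m := ⟨le_rfl, by rw [rho_refl]; exact hm0⟩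
  have hcJ : c ∈ J m := ⟨le_rfl, by rw [rho_refl]; exact hm0⟩
  have hK : ∀ x (h : a ≤ x), x ∈ I m → ∀ m',
      rho k M (show (a, c) ≤ (x, c) from ⟨h, le_rfl⟩) m' = 0 → m' = 0 := by
    intro x h hx m' h0
    by_contra hm'
    have hnot : x ∉ I m' := fun hh => hh.2 h0
    have hss : I m' ⊂ I m := by
      refine ⟨fun x' hx' => ?_, fun hh => hnot (hh hx)⟩
      refine hI m x x' hx hx'.1 ?_
      by_contra hlt
      exact hnot (hI m' x' x hx' h (le_of_not_ge hlt))
    exact absurd (hmin' m' hm') (not_le.2 (Set.ncard_lt_ncard hss (Set.toFinite _)))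
  obtain ⟨b, hbI, hb⟩ := exists_max_on (p := fun x => x ∈ I m) ⟨a, haI⟩
  obtain ⟨d, hdJ, hd⟩ := exists_max_on (p := fun x => x ∈ J m) ⟨c, hcJ⟩
  have hab : a ≤ b := hbI.1
  have hcd : c ≤ d := hdJ.1
  have hR : IsRectangle (I m ×ˢ J m) := by
    refine ⟨⟨(a, c), haI, hcJ⟩, I m, J m, ⟨?_⟩, ⟨?_⟩, rfl⟩
    · intro x hx y hy z hz
      exact hI m y z hy (hx.1.trans hz.1) hz.2
    · intro x hx y hy z hz
      exact hJ m y z hy (hx.1.trans hz.1) hz.2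
  have hle : ((a, c) : X × Y) ≤ (b, d) := ⟨hab, hcd⟩
  have hv0 : rho k M hle m ≠ 0 := by
    intro h0
    have h1 : m ∈ LinearMap.ker (rho k M hle) := h0
    rw [(hwe (a, c) (b, d) hle).2, Submodule.mem_sup] at h1
    obtain ⟨u, hu, v, hv, huv⟩ := h1
    have hu0 : u = 0 := hK b hab hbI u hu
    rw [hu0, zero_add] at huv
    rw [huv] at hv
    exact hdJ.2 hv
  have hW0 : ∀ y (h : y < c), rho k M hle m ∉
      LinearMap.range (rho k M (show (b, y) ≤ (b, d) from ⟨le_rfl, h.le.trans hcd⟩)) := by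
    intro y h hmem
    have h2 : ((a, y) : X × Y) ≤ (b, d) := ⟨hab, h.le.trans hcd⟩
    have h3 : rho k M hle m ∈ LinearMap.range (rho k M h2) := by
      rw [(hwe (a, y) (b, d) h2).1]
      exact ⟨hmem, rho k M (show (a, c) ≤ (a, d) from ⟨le_rfl, hcd⟩) m, rho_rho _ _ _⟩
    obtain ⟨z, hz⟩ := h3
    have := hc' y h
    rw [Subsingleton.elim z 0, map_zero] at hz
    exact hv0 hz.symm
  obtain ⟨W, hW, hvW⟩ : ∃ W : Submodule k (fiber M (b, d)),
      (∀ y (h : y < c),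
        LinearMap.range (rho k M (show (b, y) ≤ (b, d) from ⟨le_rfl, h.le.trans hcd⟩)) ≤ W) ∧
      rho k M hle m ∉ W := by
    by_cases hex : ∃ y, y < c
    · obtain ⟨y, hy, hmax⟩ := exists_max_on hex
      refine ⟨_, fun y' hy' => ?_, hW0 y hy⟩
      rintro _ ⟨z, rfl⟩
      exact ⟨rho k M (show (b, y') ≤ (b, y) from ⟨le_rfl, hmax y' hy'⟩) z, rho_rho _ _ _⟩
    · exact ⟨⊥, fun y h => absurd ⟨y, h⟩ hex, by simpa using hv0⟩
  obtain ⟨φ, hφ, hφW⟩ := Submodule.exists_le_ker_of_notMem hvW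
  obtain ⟨f, hf⟩ := exists_homFrom (M := M) _ hR.ordConnected (a, c) m
    (fun t ht => ⟨ht.1.1, ht.2.1⟩) (by
      rintro ⟨x, y⟩ ⟨hx, hy⟩ hn
      by_cases hxI : x ∈ I m
      · have hyJ : y ∉ J m := fun h => hn ⟨hxI, h⟩
        have : rho k M (show (a, c) ≤ (a, y) from ⟨le_rfl, hy⟩) m = 0 := by
          by_contra h
          exact hyJ ⟨hy, h⟩
        rw [← rho_rho (show (a, c) ≤ (a, y) from ⟨le_rfl, hy⟩) (show (a, y) ≤ (x, y) from ⟨hx, le_rfl⟩), this, map_zero]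
      · have : rho k M (show (a, c) ≤ (x, c) from ⟨hx, le_rfl⟩) m = 0 := by
          by_contra h
          exact hxI ⟨hx, h⟩
        rw [← rho_rho (show (a, c) ≤ (x, c) from ⟨hx, le_rfl⟩) (show (x, c) ≤ (x, y) from ⟨le_rfl, hy⟩), this, map_zero])
  obtain ⟨g, hg⟩ := exists_homTo (M := M) _ hR.ordConnected (b, d)
    ((φ (rho k M hle m))⁻¹ • φ)
    (fun t ht => ⟨hb _ ht.1, hd _ ht.2⟩) (by
      rintro ⟨x, y⟩ ⟨x', y'⟩ ⟨hxb, hyd⟩ hn ⟨hx', hy'⟩ ⟨hxx, hyy⟩ z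
      have key : φ (rho k M (show (x, y) ≤ (b, d) from ⟨hxb, hyd⟩) z) = 0 := by
        by_cases hxa : x < a
        · have := ha' x y hxa
          rw [Subsingleton.elim z 0, map_zero, map_zero]
        · by_cases hyc : y < c
          · apply hφW
            apply hW y hyc
            exact ⟨rho k M (show (x, y) ≤ (b, y) from ⟨hxb, le_rfl⟩) z, rho_rho _ _ _⟩
          · exact absurd ⟨hI m x' x hx' (not_lt.1 hxa) hxx, hJ m y' y hy' (not_lt.1 hyc) hyy⟩ hn
      simp [key])
  refine ⟨_, hR, f, g, ?_⟩
  refine pm_ext fun t z => ival_inj ?_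
  rw [ap_comp, ap_id]
  by_cases ht : t ∈ I m ×ˢ J m
  · rw [hg t ht, hf t ⟨ht.1.1, ht.2.1⟩, map_smul, rho_rho]
    simp [hφ]
  · rw [ival_zero ht, ival_zero ht]

theorem exists_dec [Fintype X] [Fintype Y] : ∀ (n : ℕ) (M : PersistenceModule k (X × Y)),
    Pfd k M → WeaklyExact k M → ∑ t, Module.finrank k (fiber M t) = n →
    ∃ (ι : Type) (_ : Fintype ι) (R : ι → Set (X × Y)) (hR : ∀ i, IsRectangle (R i)),
      Dec M R (fun i => (hR i).ordConnected) := by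
  intro n
  induction n using Nat.strong_induction_on with
  | _ n ih =>
    intro M hpfd hwe hn
    by_cases hne : ∃ t, Nontrivial (fiber M t)
    · obtain ⟨S, hS, f, g, hfg⟩ := exists_summand hwe hne
      let C := kernel g
      let i : C ⟶ M := kernel.ι g
      let p : M ⟶ C := kernel.lift g (𝟙 M - g ≫ f) (by simp [hfg])
      have hig : i ≫ g = 0 := kernel.condition g
      have hpi : p ≫ i = 𝟙 M - g ≫ f := kernel.lift_ι _ _ _
      have hip : i ≫ p = 𝟙 _ := by
        rw [← cancel_mono i, Category.assoc, hpi]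
        simp [reassoc_of% hig]
      have hfp : f ≫ p = 0 := by
        rw [← cancel_mono i, Category.assoc, hpi]
        simp [reassoc_of% hfg]
      have htot : g ≫ f + p ≫ i = 𝟙 M := by rw [hpi]; abel
      have hCp := pfd_retract i p hip hpfd
      have hCw := we_retract i p hip hwe
      have hsurj : ∀ t, Function.Surjective (ap p t) :=
        fun t x => ⟨_, ap_comp_id hip t x⟩
      have hlt : ∑ t, Module.finrank k (fiber C t) < n := by
        rw [← hn]
        obtain ⟨t, ht⟩ := hS.1
        refine Finset.sum_lt_sum (fun t _ => ?_) ⟨t, Finset.mem_univ _, ?_⟩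
        · have := hpfd t
          exact LinearMap.finrank_le_finrank_of_surjective (hsurj t)
        · have := hpfd t
          have := hCp t
          rw [← LinearMap.finrank_range_add_finrank_ker (ap p t),
            LinearMap.range_eq_top.2 (hsurj t), finrank_top]
          refine Nat.lt_add_of_pos_right ?_
          have hk : ap f t (ione hS.ordConnected ht) ∈ LinearMap.ker (ap p t) := by
            rw [LinearMap.mem_ker, ← ap_comp, hfp, ap_zero]
          refine Module.finrank_pos_iff_exists_ne_zero.2 ⟨⟨_, hk⟩, fun h0 => ?_⟩
          have h1 : ap f t (ione hS.ordConnected ht) = 0 := congrArg Subtype.val h0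
          have h2 := ap_comp_id hfg t (ione hS.ordConnected ht)
          rw [h1, map_zero] at h2
          have h3 := congrArg ival h2
          rw [map_zero, ival_ione] at h3
          exact zero_ne_one h3
      obtain ⟨ι, _, R, hR, hD⟩ := ih _ hlt C hCp hCw rfl
      refine ⟨Option ι, inferInstance, fun o => o.elim S R, ?_, 
        dec_split hS.ordConnected f g i p hfg hip hig hfp htot hD⟩
      rintro (_ | j)
      exacts [hS, hR j]
    · refine ⟨Empty, inferInstance, fun e => e.elim, fun e => e.elim,
        fun e => e.elim, fun e => e.elim, fun e => e.elim, fun e => e.elim, ?_⟩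
      refine pm_ext fun t x => ?_
      have : Subsingleton (fiber M t) := not_nontrivial_iff_subsingleton.1 fun h => hne ⟨t, h⟩
      exact Subsingleton.elim _ _

theorem rect_corners [Finite X] [Finite Y] {R : Set (X × Y)} (hR : IsRectangle R) :
    ∃ s t, s ≤ t ∧ s ∈ R ∧ t ∈ R ∧ R ⊆ Set.Icc s t := by
  obtain ⟨hne, I, J, -, -, rfl⟩ := hR
  obtain ⟨⟨x, y⟩, hx, hy⟩ := hne
  obtain ⟨a, ha, ha'⟩ := exists_min_on (p := fun x => x ∈ I) ⟨x, hx⟩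
  obtain ⟨b, hb, hb'⟩ := exists_max_on (p := fun x => x ∈ I) ⟨x, hx⟩
  obtain ⟨c, hc, hc'⟩ := exists_min_on (p := fun x => x ∈ J) ⟨y, hy⟩
  obtain ⟨d, hd, hd'⟩ := exists_max_on (p := fun x => x ∈ J) ⟨y, hy⟩
  refine ⟨(a, c), (b, d), ⟨hb' a ha, hd' c hc⟩, ⟨ha, hc⟩, ⟨hb, hd⟩, ?_⟩
  rintro ⟨u, v⟩ ⟨hu, hv⟩
  exact ⟨⟨not_lt.1 fun h => ha' u h hu, not_lt.1 fun h => hc' v h hv⟩, ⟨hb' u hu, hd' v hv⟩⟩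

theorem multiset_eq [Finite X] [Finite Y] : ∀ (A B : Multiset (Set (X × Y))),
    (∀ R ∈ A, IsRectangle R) → (∀ R ∈ B, IsRectangle R) →
    (∀ s t, s ≤ t → A.countP (fun R => s ∈ R ∧ t ∈ R) = B.countP (fun R => s ∈ R ∧ t ∈ R)) →
    A = B := by
  have step : ∀ (A B : Multiset (Set (X × Y))),
    (∀ R ∈ A, IsRectangle R) → (∀ R ∈ B, IsRectangle R) →
    (∀ s t, s ≤ t → A.countP (fun R => s ∈ R ∧ t ∈ R) = B.countP (fun R => s ∈ R ∧ t ∈ R)) →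
    ∀ R ∈ A, ∃ R' ∈ B, R ⊆ R' := by
    intro A B hA hB h R hR
    obtain ⟨s, t, hst, hs, ht, hsub⟩ := rect_corners (hA R hR)
    have : 0 < A.countP (fun R => s ∈ R ∧ t ∈ R) := Multiset.countP_pos.2 ⟨R, hR, hs, ht⟩
    rw [h s t hst, Multiset.countP_pos] at this
    obtain ⟨R', hR', hs', ht'⟩ := this
    exact ⟨R', hR', hsub.trans ((hB R' hR').ordConnected.out hs' ht')⟩
  intro A
  induction hn : Multiset.card A generalizing A with
  | zero =>
    intro B hA hB h
    obtain rfl := Multiset.card_eq_zero.1 hn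
    symm
    rw [Multiset.eq_zero_iff_forall_notMem]
    intro R hR
    obtain ⟨R', hR', -⟩ := step B 0 hB hA (fun s t hst => (h s t hst).symm) R hR
    simp at hR'
  | succ n ih =>
    intro B hA hB h
    obtain ⟨R0, hR0⟩ := Multiset.card_pos_iff_exists_mem.1 (by rw [hn]; exact Nat.succ_pos n)
    obtain ⟨R, hR, hmax⟩ := (Set.toFinite {R | R ∈ A}).exists_maximal ⟨R0, hR0⟩
    have hRB : R ∈ B := by
      obtain ⟨R', hR', h1⟩ := step A B hA hB h R hR
      obtain ⟨R'', hR'', h2⟩ := step B A hB hA (fun s t hst => (h s t hst).symm) R' hR'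
      have h3 := hmax hR'' (h1.trans h2)
      rwa [Set.Subset.antisymm h1 (h2.trans h3)]
    obtain ⟨A', rfl⟩ := Multiset.exists_cons_of_mem hR
    obtain ⟨B', rfl⟩ := Multiset.exists_cons_of_mem hRB
    congr 1
    refine ih A' (by simpa using hn) B' (fun R h => hA R (Multiset.mem_cons_of_mem h))
      (fun R h => hB R (Multiset.mem_cons_of_mem h)) (fun s t hst => ?_)
    have := h s t hst
    rw [Multiset.countP_cons, Multiset.countP_cons] at this
    exact Nat.add_right_cancel this

end Grid

theorem map_get_toList {α : Type} (A : Multiset α) :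
    (Finset.univ : Finset (Fin A.toList.length)).val.map (fun i => A.toList.get i) = A := by
  conv_rhs => rw [← Multiset.coe_toList A, ← List.ofFn_get A.toList]
  exact Fin.univ_val_map _

theorem card_fiber {α : Type} (A : Multiset α) (p : α → Prop) [DecidablePred p]
    [Fintype {i : Fin A.toList.length // p (A.toList.get i)}] :
    Fintype.card {i : Fin A.toList.length // p (A.toList.get i)} = A.countP p := by
  conv_rhs => rw [← map_get_toList A, Multiset.countP_map]
  rw [Fintype.card_subtype]
  rfl

theorem exists_equiv {α ι : Type} [Fintype ι] (R : ι → α) (A : Multiset α)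
    (hA : A = Finset.univ.val.map R) :
    ∃ e : Fin A.toList.length ≃ ι, ∀ i, A.toList.get i = R (e i) := by
  have h : ∀ a, Nonempty ({i : Fin A.toList.length // A.toList.get i = a} ≃ {i // R i = a}) := by
    intro a
    refine ⟨Fintype.equivOfCardEq ?_⟩
    rw [card_fiber A (fun x => x = a), hA, Multiset.countP_map, Fintype.card_subtype]
    rfl
  let E : ∀ a, {i : Fin A.toList.length // A.toList.get i = a} ≃ {i // R i = a} :=
    fun a => (h a).some
  refine ⟨(Equiv.sigmaFiberEquiv _).symm.trans
    ((Equiv.sigmaCongrRight E).trans (Equiv.sigmaFiberEquiv R)), fun i => ?_⟩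
  exact ((E (A.toList.get i)) ⟨i, rfl⟩).2.symm

end Helpers

/-- For any weakly exact pointwise finite-dimensional persistence module
`M` over a finite grid `X × Y`, there is a unique multiset `𝓡` of rectangles of `X × Y`
such that `M ≅ ⊕_{R ∈ 𝓡} k_R`. -/
theorem weaklyExact_rectangle_decomposition_existsUnique (k : Type) [Field k]
    (X Y : Type) [LinearOrder X] [LinearOrder Y] [Fintype X] [Fintype Y]
    (M : PersistenceModule k (X × Y)) (hpfd : Pfd k M) (hwe : WeaklyExact k M) :
    ∃! 𝓡 : Multiset (Set (X × Y)),
      ∃ h : ∀ R ∈ 𝓡, IsRectangle R,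
        Nonempty (M ≅ ∐ fun i : Fin 𝓡.toList.length =>
          indicator k (𝓡.toList.get i)
            (IsRectangle.ordConnected
              (h _ (by rw [← Multiset.mem_toList]; exact 𝓡.toList.get_mem i)))) := by
  obtain ⟨ι, _, R, hR, hD⟩ := exists_dec _ M hpfd hwe rfl
  refine ⟨Finset.univ.val.map R, ⟨?_, ?_⟩, ?_⟩
  · intro S hS
    obtain ⟨i, -, rfl⟩ := Multiset.mem_map.1 hS
    exact hR i
  · obtain ⟨e, he⟩ := exists_equiv R _ rfl
    exact (hD.reindex e _ _ he).iso
  · rintro B ⟨hB, hBiso⟩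
    have hBD := Dec.of_iso hBiso
    refine multiset_eq _ _ hB ?_ ?_
    · intro S hS
      obtain ⟨i, -, rfl⟩ := Multiset.mem_map.1 hS
      exact hR i
    · intro s t hst
      have h1 := hBD.finrank hst
      rw [← card_fiber B (fun S => s ∈ S ∧ t ∈ S)]
      refine h1.symm.trans ?_
      rw [hD.finrank hst, Multiset.countP_map, Fintype.card_subtype]
      rfl

end PersistencePaper
end
end

section
/- Let X and Y be subsets of ℤ, and let M and N be pointwise finite-dimensional rectangle-decomposable persistence modules over the product poset X × Y. If M and N have the same rank invariant, i.e. rank M(s ≤ t) = rank N(s ≤ t) for all s ≤ t in X × Y, then M and N are isomorphic. -/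
open CategoryTheory Limits Set

noncomputable section

set_option linter.unusedSectionVars false

attribute [local instance] Classical.propDecidable

namespace PersistencePaper

theorem exists_pair {P : Type} [Lattice P] (R : Set P)
    (hinf : ∀ a ∈ R, ∀ b ∈ R, a ⊓ b ∈ R) (hsup : ∀ a ∈ R, ∀ b ∈ R, a ⊔ b ∈ R)
    (p : P) (hp : p ∈ R) (G : Set (Set P)) (hG : G.Finite) :
    (∀ S ∈ G, S.OrdConnected) →
    ∃ s t, s ∈ R ∧ t ∈ R ∧ s ≤ p ∧ p ≤ t ∧ ∀ S ∈ G, s ∈ S → t ∈ S → R ⊆ S := by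
  induction G, hG using Set.Finite.induction_on with
  | empty => intro _; exact ⟨p, p, hp, hp, le_rfl, le_rfl, by simp⟩
  | @insert S G _ _ ih =>
    intro hc
    obtain ⟨s, t, hs, ht, hsp, hpt, h⟩ := ih fun S hS => hc S (Set.mem_insert_of_mem _ hS)
    have key : ∃ q ∈ R, q ∈ S → R ⊆ S := by
      by_cases hRS : R ⊆ S
      · exact ⟨p, hp, fun _ => hRS⟩
      · obtain ⟨q, hq, hqS⟩ := Set.not_subset.1 hRS
        exact ⟨q, hq, fun h => absurd h hqS⟩
    obtain ⟨q, hq, hqS⟩ := key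
    refine ⟨s ⊓ q, t ⊔ q, hinf _ hs _ hq, hsup _ ht _ hq, inf_le_left.trans hsp,
      hpt.trans le_sup_left, ?_⟩
    intro S' hS' h1 h2
    have hcv := hc S' hS'
    rcases hS' with rfl | hS'
    · exact hqS (hcv.out h1 h2 ⟨inf_le_right, le_sup_right⟩)
    · have hst : s ≤ t := hsp.trans hpt
      exact h S' hS' (hcv.out h1 h2 ⟨inf_le_left, hst.trans le_sup_left⟩)
        (hcv.out h1 h2 ⟨inf_le_left.trans hst, le_sup_left⟩)

theorem count_eq {P : Type} [Lattice P] {ι κ : Type} (A : ι → Set P) (B : κ → Set P)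
    (C : Set P → Prop)
    (hcv : ∀ S, C S → S.OrdConnected)
    (hinf : ∀ S, C S → ∀ a ∈ S, ∀ b ∈ S, a ⊓ b ∈ S)
    (hsup : ∀ S, C S → ∀ a ∈ S, ∀ b ∈ S, a ⊔ b ∈ S)
    (hA : ∀ i, C (A i)) (hB : ∀ i, C (B i))
    (fA : ∀ p, {i | p ∈ A i}.Finite) (fB : ∀ p, {i | p ∈ B i}.Finite)
    (h : ∀ s t, s ≤ t → {i | s ∈ A i ∧ t ∈ A i}.ncard = {i | s ∈ B i ∧ t ∈ B i}.ncard)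
    (p : P) (R : Set P) (hp : p ∈ R) : {i | A i = R}.ncard = {i | B i = R}.ncard := by
  set G : Set (Set P) := A '' {i | p ∈ A i} ∪ B '' {i | p ∈ B i} with hGdef
  have hG : G.Finite := ((fA p).image _).union ((fB p).image _)
  have hGC : ∀ S ∈ G, C S := by
    rintro S (⟨i, -, rfl⟩ | ⟨i, -, rfl⟩)
    exacts [hA i, hB i]
  by_contra hne
  have hsub : ∀ S, p ∈ S → {i | A i = S}.ncard ≠ {i | B i = S}.ncard → S ∈ G := by
    intro S hS hn
    by_contra hSG
    apply hn
    have h1 : {i | A i = S} = ∅ := by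
      ext i; simp only [mem_ofPred_eq, mem_empty_iff_false, iff_false]
      rintro rfl; exact hSG (Or.inl ⟨i, hS, rfl⟩)
    have h2 : {i | B i = S} = ∅ := by
      ext i; simp only [mem_ofPred_eq, mem_empty_iff_false, iff_false]
      rintro rfl; exact hSG (Or.inr ⟨i, hS, rfl⟩)
    rw [h1, h2]; simp
  set T : Set (Set P) := {S | p ∈ S ∧ {i | A i = S}.ncard ≠ {i | B i = S}.ncard} with hT
  have hTf : T.Finite := hG.subset fun S hS => hsub S hS.1 hS.2
  obtain ⟨S, hS⟩ := hTf.exists_maximal ⟨R, hp, hne⟩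
  have hSG := hsub S hS.1.1 hS.1.2
  obtain ⟨s, t, hs, ht, hsp, hpt, hst⟩ := exists_pair S (hinf S (hGC S hSG)) (hsup S (hGC S hSG))
    p hS.1.1 G hG fun S' h' => hcv S' (hGC S' h')
  have hr := h s t (hsp.trans hpt)
  have hfA : {i | s ∈ A i ∧ t ∈ A i} = {i | S ⊆ A i} := by
    ext i
    constructor
    · rintro ⟨h1, h2⟩
      exact hst _ (Or.inl ⟨i, (hcv _ (hA i)).out h1 h2 ⟨hsp, hpt⟩, rfl⟩) h1 h2
    · intro h1; exact ⟨h1 hs, h1 ht⟩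
  have hfB : {i | s ∈ B i ∧ t ∈ B i} = {i | S ⊆ B i} := by
    ext i
    constructor
    · rintro ⟨h1, h2⟩
      exact hst _ (Or.inr ⟨i, (hcv _ (hB i)).out h1 h2 ⟨hsp, hpt⟩, rfl⟩) h1 h2
    · intro h1; exact ⟨h1 hs, h1 ht⟩
  rw [hfA, hfB] at hr
  have gen : ∀ {α : Type} (D : α → Set P), {i | p ∈ D i}.Finite →
      (∀ i, p ∈ D i → D i ∈ G) →
      {i | S ⊆ D i}.ncard = ∑ b ∈ hG.toFinset.filter (S ⊆ ·), {i | D i = b}.ncard := by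
    intro α D hf hDG
    have hf' : {i | S ⊆ D i}.Finite := hf.subset fun i hi => hi hS.1.1
    rw [Set.ncard_eq_toFinset_card _ hf',
      Finset.card_eq_sum_card_fiberwise (f := D) (t := hG.toFinset.filter (S ⊆ ·))]
    · refine Finset.sum_congr rfl fun b hb => ?_
      rw [← Set.ncard_coe_finset]
      congr 1
      ext i
      simp only [Finset.mem_filter, Set.Finite.mem_toFinset] at hb
      simp only [Finset.coe_filter, Set.Finite.mem_toFinset, mem_ofPred_eq]
      constructor
      · exact fun h => h.2
      · rintro rfl; exact ⟨hb.2, rfl⟩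
    · intro i hi
      simp only [Set.Finite.coe_toFinset, mem_ofPred_eq] at hi
      simp only [Finset.coe_filter, Set.Finite.mem_toFinset, mem_ofPred_eq]
      exact ⟨hDG i (hi hS.1.1), hi⟩
  rw [gen A (fA p) fun i hi => Or.inl ⟨i, hi, rfl⟩,
    gen B (fB p) fun i hi => Or.inr ⟨i, hi, rfl⟩] at hr
  have hmem : S ∈ hG.toFinset.filter (S ⊆ ·) := by simp [hSG]
  rw [← Finset.add_sum_erase _ _ hmem, ← Finset.add_sum_erase _ _ hmem] at hr
  have hrest : ∑ b ∈ (hG.toFinset.filter (S ⊆ ·)).erase S, {i | A i = b}.ncard =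
      ∑ b ∈ (hG.toFinset.filter (S ⊆ ·)).erase S, {i | B i = b}.ncard := by
    refine Finset.sum_congr rfl fun b hb => ?_
    simp only [Finset.mem_erase, Finset.mem_filter] at hb
    by_contra hn
    exact hb.1 (Set.Subset.antisymm (hS.2 (y := b) ⟨hb.2.2 hS.1.1, hn⟩ hb.2.2) hb.2.2)
  rw [hrest] at hr
  exact hS.1.2 (Nat.add_right_cancel hr)

/-- The explicit direct sum. -/
def bigSum (k : Type) [Field k] {P : Type} [Preorder P] {ι : Type} (R : ι → Set P)
    (hR : ∀ i, (R i).OrdConnected) : PersistenceModule k P where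
  obj t := ModuleCat.of k (Finsupp.supported k k {i | t ∈ R i})
  map {s t} _ := ModuleCat.ofHom
    ((Finsupp.restrictDom k k {i | t ∈ R i}).comp (Submodule.subtype _))
  map_id t := by
    refine ModuleCat.hom_ext <| LinearMap.ext fun x => ?_
    exact LinearMap.congr_fun (Finsupp.restrictDom_comp_subtype (M := k) (R := k) {i | t ∈ R i}) x
  map_comp {s t u} f g := by
    refine ModuleCat.hom_ext <| LinearMap.ext fun x => Subtype.ext <| Finsupp.ext fun i => ?_
    have hx := (Finsupp.mem_supported' k x.1).1 x.2 i
    simp only [mem_ofPred_eq] at hx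
    by_cases hs : s ∈ R i <;> by_cases hu : u ∈ R i
    · have ht : t ∈ R i := (hR i).out hs hu ⟨leOfHom f, leOfHom g⟩
      simp [Finsupp.filter_apply, ht, hu]
    · simp [Finsupp.filter_apply, hu]
    · simp [Finsupp.filter_apply, hu, hx hs]
    · simp [Finsupp.filter_apply, hu]

theorem bigSum_map_apply (k : Type) [Field k] {P : Type} [Preorder P] {ι : Type} (R : ι → Set P)
    (hR : ∀ i, (R i).OrdConnected) {s t : P} (f : s ⟶ t)
    (x : Finsupp.supported k k {i | s ∈ R i}) (i : ι) :
    (show Finsupp.supported k k {i | t ∈ R i} from ((bigSum k R hR).map f).hom x).1 i =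
      if t ∈ R i then x.1 i else 0 := by
  show (Finsupp.restrictDom k k {i | t ∈ R i} x.1).1 i = _
  rw [Finsupp.restrictDom_apply, Finsupp.filter_apply]
  rfl

/-- Inclusions at a point. -/
def bigInc (k : Type) [Field k] {P : Type} [Preorder P] {ι : Type} (R : ι → Set P) (i : ι) (t : P) :
    indSub k (R i) t →ₗ[k] Finsupp.supported k k {i | t ∈ R i} :=
  LinearMap.codRestrict _ ((Finsupp.lsingle i).comp (Submodule.subtype _)) (by
    intro x
    rw [Finsupp.mem_supported']
    intro j hj
    by_cases h : i = j
    · subst h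
      have := x.2 hj
      simp [this]
    · simp [Finsupp.single_apply, h])

/-- Projection of `k` onto the indicator fiber. -/
def indProj (k : Type) [Field k] {P : Type} [Preorder P] (Q : Set P) (t : P) :
    k →ₗ[k] indSub k Q t where
  toFun x := ⟨if t ∈ Q then x else 0, fun h => if_neg h⟩
  map_add' x y := by apply Subtype.ext; simp only [Submodule.coe_add]; split_ifs <;> simp
  map_smul' c x := by apply Subtype.ext; simp

theorem indProj_coe (k : Type) [Field k] {P : Type} [Preorder P] (Q : Set P) (t : P)
    (x : indSub k Q t) : indProj k Q t x.1 = x := by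
  apply Subtype.ext
  show (if t ∈ Q then x.1 else 0) = x.1
  split_ifs with h
  · rfl
  · exact (x.2 h).symm

theorem bigSum_ext (k : Type) [Field k] {P : Type} [Preorder P] {ι : Type} (R : ι → Set P) (t : P)
    {V : Type} [AddCommGroup V] [Module k V]
    (f g : Finsupp.supported k k {i | t ∈ R i} →ₗ[k] V)
    (h : ∀ i, f.comp (bigInc k R i t) = g.comp (bigInc k R i t)) : f = g := by
  have key : f.comp (Finsupp.restrictDom k k {i | t ∈ R i}) =
      g.comp (Finsupp.restrictDom k k {i | t ∈ R i}) := by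
    refine Finsupp.lhom_ext' fun i => LinearMap.ext fun x => ?_
    have e : Finsupp.restrictDom k k {i | t ∈ R i} (Finsupp.single i x) =
        bigInc k R i t (indProj k (R i) t x) := by
      apply Subtype.ext
      rw [Finsupp.restrictDom_apply]
      show _ = Finsupp.single i (if t ∈ R i then x else 0)
      by_cases hi : t ∈ R i
      · rw [if_pos hi, Finsupp.filter_single_of_pos _ (by exact hi)]
      · rw [if_neg hi, Finsupp.filter_single_of_neg _ (by exact hi), Finsupp.single_zero]
    simp only [LinearMap.comp_apply, Finsupp.lsingle_apply]
    rw [e]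
    exact LinearMap.congr_fun (h i) _
  refine LinearMap.ext fun x => ?_
  have e := LinearMap.congr_fun (Finsupp.restrictDom_comp_subtype (M := k) (R := k) {i | t ∈ R i}) x
  have := LinearMap.congr_fun key x.1
  simp only [LinearMap.comp_apply, Submodule.subtype_apply, LinearMap.id_apply] at this e
  rwa [e] at this

/-- Injection natural transformation. -/
def bigInj (k : Type) [Field k] {P : Type} [Preorder P] {ι : Type} (R : ι → Set P)
    (hR : ∀ i, (R i).OrdConnected) (i : ι) : indicator k (R i) (hR i) ⟶ bigSum k R hR where
  app t := ModuleCat.ofHom (bigInc k R i t)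
  naturality s t f := by
    refine ModuleCat.hom_ext <| LinearMap.ext fun x => Subtype.ext <| Finsupp.ext fun j => ?_
    refine Eq.trans ?_ (bigSum_map_apply k R hR f (bigInc k R i s x) j).symm
    show Finsupp.single i (if s ∈ R i ∧ t ∈ R i then x.1 else 0) j =
      if t ∈ R j then Finsupp.single i x.1 j else 0
    by_cases h : i = j
    · subst h
      by_cases hs : s ∈ R i
      · simp [hs]
      · have : x.1 = 0 := x.2 hs
        simp [this]
    · simp [Finsupp.single_apply, h]

/-- Descent at a point. -/
def bigDesc (k : Type) [Field k] {P : Type} [Preorder P] {ι : Type} (R : ι → Set P) (t : P)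
    {V : Type} [AddCommGroup V] [Module k V] (g : ∀ i, indSub k (R i) t →ₗ[k] V) :
    Finsupp.supported k k {i | t ∈ R i} →ₗ[k] V :=
  (Finsupp.lsum k fun i => (g i).comp (indProj k (R i) t)).comp (Submodule.subtype _)

theorem bigDesc_inc (k : Type) [Field k] {P : Type} [Preorder P] {ι : Type} (R : ι → Set P) (t : P)
    {V : Type} [AddCommGroup V] [Module k V] (g : ∀ i, indSub k (R i) t →ₗ[k] V) (i : ι) :
    (bigDesc k R t g).comp (bigInc k R i t) = g i := by
  refine LinearMap.ext fun x => ?_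
  show (Finsupp.lsum k fun i => (g i).comp (indProj k (R i) t)) (Finsupp.single i x.1) = g i x
  rw [Finsupp.lsum_single, LinearMap.comp_apply, indProj_coe]

/-- Descent natural transformation. -/
def bigDescNat (k : Type) [Field k] {P : Type} [Preorder P] {ι : Type} (R : ι → Set P)
    (hR : ∀ i, (R i).OrdConnected) (Z : PersistenceModule k P)
    (g : ∀ i, indicator k (R i) (hR i) ⟶ Z) : bigSum k R hR ⟶ Z where
  app t := ModuleCat.ofHom (bigDesc k R t fun i => ((g i).app t).hom)
  naturality s t f := by
    refine ModuleCat.hom_ext (bigSum_ext k R s _ _ fun i => ?_)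
    have n1 := congrArg ModuleCat.Hom.hom ((bigInj k R hR i).naturality f)
    have n2 := congrArg ModuleCat.Hom.hom ((g i).naturality f)
    have d1 := bigDesc_inc k R t (fun i => ((g i).app t).hom) i
    have d2 := bigDesc_inc k R s (fun i => ((g i).app s).hom) i
    refine LinearMap.ext fun x => ?_
    have a1 := LinearMap.congr_fun n1 x
    have a2 := LinearMap.congr_fun n2 x
    have a3 := LinearMap.congr_fun d1 (((indicator k (R i) (hR i)).map f).hom x)
    have a4 := LinearMap.congr_fun d2 x
    have a5 := congrArg (bigDesc k R t fun i => ((g i).app t).hom) a1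
    have a6 := congrArg (Z.map f).hom a4
    exact (a5.symm.trans a3).trans (a2.trans a6.symm)

theorem sigma_iso (k : Type) [Field k] {P : Type} [Preorder P] {ι : Type} (R : ι → Set P)
    (hR : ∀ i, (R i).OrdConnected) :
    Nonempty ((∐ fun i => indicator k (R i) (hR i)) ≅ bigSum k R hR) := by
  refine ⟨(coproductIsCoproduct _).coconePointUniqueUpToIso
    (t := Cofan.mk (bigSum k R hR) (bigInj k R hR)) (Cofan.IsColimit.mk _
      (fun c => bigDescNat k R hR c.pt c.inj) ?_ ?_)⟩
  · intro c i
    refine NatTrans.ext (funext fun t => ModuleCat.hom_ext ?_)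
    exact bigDesc_inc k R t (fun i => ((c.inj i).app t).hom) i
  · intro c m hm
    refine NatTrans.ext (funext fun t => ModuleCat.hom_ext ?_)
    refine bigSum_ext k R t _ _ fun i => ?_
    refine Eq.trans ?_ (bigDesc_inc k R t (fun i => ((c.inj i).app t).hom) i).symm
    exact congrArg (fun f : indicator k (R i) (hR i) ⟶ c.pt => (f.app t).hom) (hm i)

theorem finrank_supported (k : Type) [Field k] {ι : Type} (S : Set ι) :
    Module.finrank k (Finsupp.supported k k S) = S.ncard := by
  rw [Module.finrank_eq_nat_card_basis (Module.Basis.ofRepr (Finsupp.supportedEquivFinsupp S))]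
  rfl

theorem rk_bigSum (k : Type) [Field k] {P : Type} [Preorder P] {ι : Type} (R : ι → Set P)
    (hR : ∀ i, (R i).OrdConnected) {s t : P} (h : s ≤ t) :
    rk k (bigSum k R hR) s t = {i | s ∈ R i ∧ t ∈ R i}.ncard := by
  rw [rk, dif_pos h, ← finrank_supported k]
  have : (LinearMap.range (rho k (bigSum k R hR) h)).map
      (Submodule.subtype (Finsupp.supported k k {i | t ∈ R i})) =
      Finsupp.supported k k {i | s ∈ R i ∧ t ∈ R i} := by
    ext y
    constructor
    · rintro ⟨_, ⟨x, rfl⟩, rfl⟩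
      rw [Finsupp.mem_supported']
      intro i hi
      have e := bigSum_map_apply k R hR (homOfLE h) x i
      refine e.trans ?_
      have hx := (Finsupp.mem_supported' k x.1).1 x.2 i
      by_cases ht : t ∈ R i
      · rw [if_pos ht]
        exact hx fun hs => hi ⟨hs, ht⟩
      · rw [if_neg ht]
    · intro hy
      have hys : y ∈ Finsupp.supported k k {i | s ∈ R i} :=
        Finsupp.supported_mono (fun i hi => hi.1) hy
      refine ⟨_, ⟨(⟨y, hys⟩ : Finsupp.supported k k {i | s ∈ R i}), rfl⟩, Finsupp.ext fun i => ?_⟩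
      refine (bigSum_map_apply k R hR (homOfLE h) ⟨y, hys⟩ i).trans ?_
      split_ifs with ht
      · rfl
      · exact ((Finsupp.mem_supported' k y).1 hy i fun hi => ht hi.2).symm
  rw [← this]
  exact (Submodule.finrank_map_subtype_eq _ _).symm

theorem rk_iso (k : Type) [Field k] {P : Type} [Preorder P] {M N : PersistenceModule k P}
    (e : M ≅ N) (s t : P) : rk k M s t = rk k N s t := by
  unfold rk
  split_ifs with h
  · let es := (e.app s).toLinearEquiv
    let et := (e.app t).toLinearEquiv
    have hn : (et : M.obj t →ₗ[k] N.obj t).comp (rho k M h) =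
        (rho k N h).comp (es : M.obj s →ₗ[k] N.obj s) :=
      congrArg ModuleCat.Hom.hom (e.hom.naturality (homOfLE h))
    rw [← LinearEquiv.finrank_map_eq et, ← LinearMap.range_comp, hn,
      LinearMap.range_comp_of_range_eq_top _ (LinearEquiv.range es)]
  · rfl

theorem finite_of_pfd (k : Type) [Field k] {P : Type} [Preorder P] {M : PersistenceModule k P}
    (hM : Pfd k M) {ι : Type} (R : ι → Set P)
    (hR : ∀ i, (R i).OrdConnected) (e : M ≅ bigSum k R hR) (p : P) : {i | p ∈ R i}.Finite := by
  have := hM p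
  have hf : FiniteDimensional k ({i | p ∈ R i} →₀ k) :=
    ((e.app p).toLinearEquiv.trans
      (Finsupp.supportedEquivFinsupp (M := k) (R := k) {i | p ∈ R i})).finiteDimensional
  exact Module.Finite.finite_basis (Finsupp.basisSingleOne (R := k) (ι := {i | p ∈ R i}))

theorem IsRectangle.inf_sup {X Y : Set ℤ} {S : Set (↥X × ↥Y)} (h : IsRectangle S) :
    (∀ a ∈ S, ∀ b ∈ S, a ⊓ b ∈ S) ∧ (∀ a ∈ S, ∀ b ∈ S, a ⊔ b ∈ S) := by
  obtain ⟨-, I, J, -, -, rfl⟩ := h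
  refine ⟨fun a ha b hb => ⟨?_, ?_⟩, fun a ha b hb => ⟨?_, ?_⟩⟩
  · rcases le_total a.1 b.1 with h | h
    · rw [Prod.fst_inf, inf_eq_left.2 h]; exact ha.1
    · rw [Prod.fst_inf, inf_eq_right.2 h]; exact hb.1
  · rcases le_total a.2 b.2 with h | h
    · rw [Prod.snd_inf, inf_eq_left.2 h]; exact ha.2
    · rw [Prod.snd_inf, inf_eq_right.2 h]; exact hb.2
  · rcases le_total a.1 b.1 with h | h
    · rw [Prod.fst_sup, sup_eq_right.2 h]; exact hb.1
    · rw [Prod.fst_sup, sup_eq_left.2 h]; exact ha.1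
  · rcases le_total a.2 b.2 with h | h
    · rw [Prod.snd_sup, sup_eq_right.2 h]; exact hb.2
    · rw [Prod.snd_sup, sup_eq_left.2 h]; exact ha.2

theorem indicator_iso_of_eq (k : Type) [Field k] {P : Type} [Preorder P] {Q Q' : Set P}
    (h : Q = Q') (hQ : Q.OrdConnected) (hQ' : Q'.OrdConnected) :
    Nonempty (indicator k Q hQ ≅ indicator k Q' hQ') := by
  subst h; exact ⟨Iso.refl _⟩

theorem exists_equiv_s2 {P ι κ : Type} (A : ι → Set P) (B : κ → Set P)
    (hA : ∀ i, (A i).Nonempty) (hB : ∀ i, (B i).Nonempty)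
    (fA : ∀ p, {i | p ∈ A i}.Finite) (fB : ∀ p, {i | p ∈ B i}.Finite)
    (h : ∀ R : Set P, R.Nonempty → {i | A i = R}.ncard = {i | B i = R}.ncard) :
    ∃ e : ι ≃ κ, ∀ i, B (e i) = A i := by
  have key : ∀ R : Set P, Nonempty ({i // A i = R} ≃ {i // B i = R}) := by
    intro R
    rcases R.eq_empty_or_nonempty with rfl | hR
    · have : IsEmpty {i // A i = ∅} := ⟨fun i => (hA i.1).ne_empty i.2⟩
      have : IsEmpty {i // B i = ∅} := ⟨fun i => (hB i.1).ne_empty i.2⟩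
      exact ⟨Equiv.equivOfIsEmpty _ _⟩
    · obtain ⟨p, hp⟩ := hR
      have : Finite {i // A i = R} := ((fA p).subset fun i (hi : A i = R) => by
        show p ∈ A i
        rw [hi]; exact hp).to_subtype
      have : Finite {i // B i = R} := ((fB p).subset fun i (hi : B i = R) => by
        show p ∈ B i
        rw [hi]; exact hp).to_subtype
      exact (Finite.card_eq (α := {i // A i = R}) (β := {i // B i = R})).1 (h R ⟨p, hp⟩)
  let e := fun R => (key R).some
  refine ⟨(Equiv.sigmaFiberEquiv A).symm.trans
    ((Equiv.sigmaCongrRight e).trans (Equiv.sigmaFiberEquiv B)), fun i => ?_⟩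
  exact (e (A i) ⟨i, rfl⟩).2

/-- The rank invariant is a complete invariant on pfd
rectangle-decomposable persistence modules over `X × Y ⊆ ℤ × ℤ`. -/
theorem rank_invariant_complete_on_rectangleDecomposable (k : Type) [Field k]
    (X Y : Set ℤ)
    (M N : PersistenceModule k (↥X × ↥Y)) (hM : Pfd k M) (hN : Pfd k N)
    (hMrect : RectangleDecomposable k M) (hNrect : RectangleDecomposable k N)
    (hrank : ∀ s t : ↥X × ↥Y, s ≤ t → rk k M s t = rk k N s t) :
    Nonempty (M ≅ N) := by
  obtain ⟨ι, A, hA, ⟨eM⟩⟩ := hMrect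
  obtain ⟨κ, B, hB, ⟨eN⟩⟩ := hNrect
  obtain ⟨sA⟩ := sigma_iso k A fun i => (hA i).ordConnected
  obtain ⟨sB⟩ := sigma_iso k B fun i => (hB i).ordConnected
  have fA := finite_of_pfd k hM A _ (eM ≪≫ sA)
  have fB := finite_of_pfd k hN B _ (eN ≪≫ sB)
  have hcount : ∀ s t, s ≤ t →
      {i | s ∈ A i ∧ t ∈ A i}.ncard = {i | s ∈ B i ∧ t ∈ B i}.ncard := by
    intro s t h
    rw [← rk_bigSum k A (fun i => (hA i).ordConnected) h,
      ← rk_bigSum k B (fun i => (hB i).ordConnected) h,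
      ← rk_iso k (eM ≪≫ sA), ← rk_iso k (eN ≪≫ sB)]
    exact hrank s t h
  obtain ⟨e, he⟩ := exists_equiv_s2 A B (fun i => (hA i).1) (fun i => (hB i).1) fA fB
    (fun R ⟨p, hp⟩ => count_eq A B IsRectangle (fun S h => h.ordConnected)
      (fun S h => h.inf_sup.1) (fun S h => h.inf_sup.2) hA hB fA fB hcount p R hp)
  exact ⟨eM ≪≫ Sigma.whiskerEquiv e (fun i => (indicator_iso_of_eq k (he i)
    (hB (e i)).ordConnected (hA i).ordConnected).some) ≪≫ eN.symm⟩

end PersistencePaper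
end
end

section
/- Let M be a pointwise finite-dimensional persistence module over ℤ² with a rectangle decomposition M ≅ ⊕_{R ∈ 𝓡} k_R for a multiset 𝓡 of rectangles of ℤ². For s = (s_x, s_y) ≤ t = (t_x, t_y) in ℤ², let m(s, t⁺) denote the number (with multiplicity) of rectangles R ∈ 𝓡 that contain t and have s as lower-left corner, i.e. s ∈ R, (s_x−1, s_y) ∉ R and (s_x, s_y−1) ∉ R. Then m(s, t⁺) = r(s, t) − r((s_x−1, s_y), t) − r((s_x, s_y−1), t) + r((s_x−1, s_y−1), t), where r(u, v) denotes the rank of ρ_u^v. -/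
open CategoryTheory Limits Set

noncomputable section

set_option linter.unusedSectionVars false

attribute [local instance] Classical.propDecidable

namespace PersistencePaper

section Aux

variable (k : Type) [Field k] {P : Type} [Preorder P] {ι : Type}
  (R : ι → Set P) (hR : ∀ i, (R i).OrdConnected)

abbrev auxC : PersistenceModule k P := ∐ fun i => indicator k (R i) (hR i)

/-- images of the generators in the coproduct -/
def auxE (i : ι) (u : P) : (auxC k R hR).obj u :=
  ((Sigma.ι (fun i => indicator k (R i) (hR i)) i).app u).hom
    (⟨if u ∈ R i then 1 else 0, by intro h; simp [h]⟩ : indSub k (R i) u)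

def auxPi (j : ι) (u : P) : (auxC k R hR).obj u →ₗ[k] k :=
  (indSub k (R j) u).subtype ∘ₗ
    ((Sigma.π (fun i => indicator k (R i) (hR i)) j).app u).hom

theorem auxPi_self (j : ι) (u : P) (hu : u ∈ R j) : auxPi k R hR j u (auxE k R hR j u) = 1 := by
  have h := Sigma.ι_π_eq_id (fun i => indicator k (R i) (hR i)) j
  have h2 := congrArg (fun f : indicator k (R j) (hR j) ⟶ indicator k (R j) (hR j) => (NatTrans.app f u).hom
    (⟨if u ∈ R j then 1 else 0, by intro h; simp [h]⟩ : indSub k (R j) u)) h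
  have h3 := congrArg (fun x : indSub k (R j) u => (x : k)) h2
  refine h3.trans ?_
  show (if u ∈ R j then (1:k) else 0) = 1
  simp [hu]

theorem auxPi_ne (i j : ι) (hij : i ≠ j) (u : P) : auxPi k R hR j u (auxE k R hR i u) = 0 := by
  have h := Sigma.ι_π_of_ne (fun i => indicator k (R i) (hR i)) hij
  have h2 := congrArg (fun f : indicator k (R i) (hR i) ⟶ indicator k (R j) (hR j) => (NatTrans.app f u).hom
    (⟨if u ∈ R i then 1 else 0, by intro h; simp [h]⟩ : indSub k (R i) u)) h
  exact congrArg (fun x : indSub k (R j) u => (x : k)) h2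

theorem aux_indep (u : P) :
    LinearIndependent k (fun i : {i // u ∈ R i} => auxE k R hR i.1 u) := by
  rw [linearIndependent_iff']
  intro S g hg j hj
  have h := congrArg (auxPi k R hR j.1 u) hg
  rw [map_sum, map_zero, Finset.sum_eq_single j] at h
  · rw [map_smul, auxPi_self k R hR _ _ j.2] at h
    simpa using h
  · intro b _ hb
    rw [map_smul, auxPi_ne k R hR _ _ (fun h => hb (Subtype.ext h)), smul_zero]
  · intro h; exact absurd hj h

theorem aux_span (u : P) :
    Submodule.span k (Set.range fun i => auxE k R hR i u) = ⊤ := by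
  set N := Submodule.span k (Set.range fun i => auxE k R hR i u) with hN
  have hc := isColimitOfPreserves ((evaluation P (ModuleCat k)).obj u)
    (colimit.isColimit (Discrete.functor fun i => indicator k (R i) (hR i)))
  have key : (ModuleCat.ofHom N.mkQ : (auxC k R hR).obj u ⟶ ModuleCat.of k (_ ⧸ N)) = 0 := by
    refine hc.hom_ext ?_
    rintro ⟨i⟩
    refine ModuleCat.hom_ext <| LinearMap.ext fun (x : indSub k (R i) u) => ?_
    have hx : x = (x : k) • (⟨if u ∈ R i then 1 else 0, by intro h; simp [h]⟩ :
        indSub k (R i) u) := by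
      apply Subtype.ext
      by_cases h : u ∈ R i
      · simp [h]
      · simpa [h] using x.2 h
    rw [hx]
    show N.mkQ (((Sigma.ι (fun i => indicator k (R i) (hR i)) i).app u).hom _) = 0
    rw [Submodule.mkQ_apply, Submodule.Quotient.mk_eq_zero]
    refine (congrArg (· ∈ N) (LinearMap.map_smul
      ((Sigma.ι (fun i => indicator k (R i) (hR i)) i).app u).hom (x : k) _)).mpr ?_
    exact N.smul_mem _ (Submodule.subset_span ⟨i, rfl⟩)
  have : N.mkQ = 0 := congrArg ModuleCat.Hom.hom key
  rw [← N.ker_mkQ, this, LinearMap.ker_zero]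

theorem aux_rho (i : ι) {u v : P} (h : u ≤ v) (hu : u ∈ R i ∧ v ∈ R i) :
    rho k (auxC k R hR) h (auxE k R hR i u) = auxE k R hR i v := by
  have hn := (Sigma.ι (fun i => indicator k (R i) (hR i)) i).naturality (homOfLE h)
  have h2 := congrArg (fun f => f.hom
    (⟨if u ∈ R i then 1 else 0, by intro h; simp [h]⟩ : indSub k (R i) u)) hn
  refine h2.symm.trans ?_
  show ((Sigma.ι (fun i => indicator k (R i) (hR i)) i).app v).hom (indMap k (R i) u v _) = _
  unfold auxE
  congr 1
  apply Subtype.ext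
  rw [indMap_coe]
  simp [hu]

theorem aux_rho_zero (i : ι) {u v : P} (h : u ≤ v) (hu : ¬ (u ∈ R i ∧ v ∈ R i)) :
    rho k (auxC k R hR) h (auxE k R hR i u) = 0 := by
  have hn := (Sigma.ι (fun i => indicator k (R i) (hR i)) i).naturality (homOfLE h)
  have h2 := congrArg (fun f => f.hom
    (⟨if u ∈ R i then 1 else 0, by intro h; simp [h]⟩ : indSub k (R i) u)) hn
  refine h2.symm.trans ?_
  show ((Sigma.ι (fun i => indicator k (R i) (hR i)) i).app v).hom (indMap k (R i) u v _) = _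
  rw [← map_zero ((Sigma.ι (fun i => indicator k (R i) (hR i)) i).app v).hom]
  congr 1
  apply Subtype.ext
  rw [indMap_coe]
  simp [hu]
  rfl

theorem aux_range {u v : P} (h : u ≤ v) :
    LinearMap.range (rho k (auxC k R hR) h) =
      Submodule.span k (Set.range fun i : {i // u ∈ R i ∧ v ∈ R i} => auxE k R hR i.1 v) := by
  rw [LinearMap.range_eq_map, ← aux_span, Submodule.map_span]
  apply le_antisymm
  · rw [Submodule.span_le]
    rintro _ ⟨_, ⟨i, rfl⟩, rfl⟩
    by_cases hi : u ∈ R i ∧ v ∈ R i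
    · exact Submodule.subset_span ⟨⟨i, hi⟩, (aux_rho k R hR i h hi).symm⟩
    · show rho k (auxC k R hR) h (auxE k R hR i u) ∈ _
      rw [aux_rho_zero k R hR i h hi]
      exact Submodule.zero_mem _
  · rw [Submodule.span_le]
    rintro _ ⟨i, rfl⟩
    exact Submodule.subset_span ⟨_, ⟨i.1, rfl⟩, aux_rho k R hR i.1 h i.2⟩

theorem aux_rk {u v : P} (h : u ≤ v) (hf : {i | v ∈ R i}.Finite) :
    rk k (auxC k R hR) u v = {i | u ∈ R i ∧ v ∈ R i}.ncard := by
  have hf' : {i | u ∈ R i ∧ v ∈ R i}.Finite := hf.subset fun i hi => hi.2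
  have : Fintype {i // u ∈ R i ∧ v ∈ R i} := hf'.fintype
  have hli : LinearIndependent k
      (fun i : {i // u ∈ R i ∧ v ∈ R i} => auxE k R hR i.1 v) :=
    (aux_indep k R hR v).comp (fun i : {i // u ∈ R i ∧ v ∈ R i} => ⟨i.1, i.2.2⟩)
      (fun a b hab => Subtype.ext (congrArg (fun x => x.1) hab))
  rw [rk, dif_pos h, aux_range, finrank_span_eq_card hli, ← Nat.card_eq_fintype_card]
  rfl

theorem aux_rk_iso {M N : PersistenceModule k P} (e : M ≅ N) (u v : P) :
    rk k M u v = rk k N u v := by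
  unfold rk
  split_ifs with h
  · let eu := (e.app u).toLinearEquiv
    let ev := (e.app v).toLinearEquiv
    have hn : ev.toLinearMap ∘ₗ rho k M h = rho k N h ∘ₗ eu.toLinearMap :=
      congrArg ModuleCat.Hom.hom (e.hom.naturality (homOfLE h))
    have : LinearMap.range (rho k N h) = (LinearMap.range (rho k M h)).map ev.toLinearMap := by
      rw [← LinearMap.range_comp, hn, LinearMap.range_comp, LinearEquiv.range,
        LinearMap.range_eq_map]
    rw [this]
    exact (LinearEquiv.finrank_map_eq ev _).symm
  · rfl

theorem aux_finite {M : PersistenceModule k P} (hpfd : Pfd k M) (iso : M ≅ auxC k R hR)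
    (t : P) : {i | t ∈ R i}.Finite := by
  have := hpfd t
  have : FiniteDimensional k ((auxC k R hR).obj t) :=
    Module.Finite.equiv (iso.app t).toLinearEquiv
  have hf : Finite {i // t ∈ R i} := (aux_indep k R hR t).finite
  exact hf

end Aux

/-- Inclusion-exclusion formula for the number `m(s,t⁺)` of rectangle
summands containing `t` and with lower-left corner `s`, in terms of the rank invariant. -/
theorem count_lower_left_corner_eq_inclusion_exclusion (k : Type) [Field k]
    (M : PersistenceModule k (ℤ × ℤ)) (hpfd : Pfd k M)
    (ι : Type) (R : ι → Set (ℤ × ℤ)) (hR : ∀ i, IsRectangle (R i))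
    (iso : M ≅ ∐ fun i => indicator k (R i) (hR i).ordConnected)
    (s t : ℤ × ℤ) (h : s ≤ t) :
    ({i | t ∈ R i ∧ s ∈ R i ∧ (s.1 - 1, s.2) ∉ R i ∧ (s.1, s.2 - 1) ∉ R i}.ncard : ℤ) =
      (rk k M s t : ℤ) - rk k M (s.1 - 1, s.2) t - rk k M (s.1, s.2 - 1) t +
        rk k M (s.1 - 1, s.2 - 1) t := by
  have hR' : ∀ i, (R i).OrdConnected := fun i => (hR i).ordConnected
  have hf : {i | t ∈ R i}.Finite := aux_finite k R hR' hpfd iso t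
  obtain ⟨a, b⟩ := s
  have h1 : ((a - 1, b) : ℤ × ℤ) ≤ (a, b) := ⟨by simp, le_refl _⟩
  have h2 : ((a, b - 1) : ℤ × ℤ) ≤ (a, b) := ⟨le_refl _, by simp⟩
  have h31 : ((a - 1, b - 1) : ℤ × ℤ) ≤ (a - 1, b) := ⟨le_refl _, by simp⟩
  have h32 : ((a - 1, b - 1) : ℤ × ℤ) ≤ (a, b - 1) := ⟨by simp, le_refl _⟩
  have hrk : ∀ u, u ≤ t → rk k M u t = {i | u ∈ R i ∧ t ∈ R i}.ncard := fun u hu =>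
    (aux_rk_iso k iso u t).trans (aux_rk k R hR' hu hf)
  simp only
  rw [hrk _ h, hrk _ (h1.trans h), hrk _ (h2.trans h), hrk _ ((h31.trans h1).trans h)]
  set A : ℤ × ℤ → Set ι := fun u => {i | u ∈ R i ∧ t ∈ R i} with hA
  have fin : ∀ u, (A u).Finite := fun u => hf.subset fun i hi => hi.2
  have mono : ∀ u v, u ≤ v → v ≤ t → A u ⊆ A v := fun u v huv hvt i hi =>
    ⟨(hR' i).out hi.1 hi.2 ⟨huv, hvt⟩, hi.2⟩
  have hint : A (a - 1, b) ∩ A (a, b - 1) = A (a - 1, b - 1) := by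
    apply Set.Subset.antisymm
    · rintro i ⟨⟨hi1, ht⟩, ⟨hi2, -⟩⟩
      refine ⟨?_, ht⟩
      obtain ⟨-, I, J, -, -, e⟩ := hR i
      rw [e] at hi1 hi2 ⊢
      exact ⟨hi1.1, hi2.2⟩
    · exact Set.subset_inter (mono _ _ h31 (h1.trans h)) (mono _ _ h32 (h2.trans h))
  have hS : {i | t ∈ R i ∧ (a, b) ∈ R i ∧ (a - 1, b) ∉ R i ∧ (a, b - 1) ∉ R i} =
      A (a, b) \ (A (a - 1, b) ∪ A (a, b - 1)) := by
    ext i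
    simp only [hA, Set.mem_ofPred_eq, Set.mem_sdiff, Set.mem_union]
    tauto
  have e1 := Set.ncard_sdiff_add_ncard_of_subset
    (Set.union_subset (mono _ _ h1 h) (mono _ _ h2 h)) (fin (a, b))
  have e2 := Set.ncard_union_add_ncard_inter (A (a - 1, b)) (A (a, b - 1)) (fin _) (fin _)
  rw [hint] at e2
  rw [hS]
  change ((A (a, b) \ (A (a - 1, b) ∪ A (a, b - 1))).ncard : ℤ) =
    (A (a, b)).ncard - (A (a - 1, b)).ncard - (A (a, b - 1)).ncard + (A (a - 1, b - 1)).ncard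
  omega

end PersistencePaper
end
end

section
/- Let M be a pointwise finite-dimensional persistence module over ℤ with an interval decomposition M ≅ ⊕_{I ∈ 𝓑} k_I for a multiset 𝓑 of intervals of ℤ. Then for all s ≤ t in ℤ, the multiplicity in 𝓑 of the interval [s, t] = {s, s+1, …, t} equals r(s, t) − r(s−1, t) − r(s, t+1) + r(s−1, t+1), where r(u, v) denotes the rank of ρ_u^v. -/
open CategoryTheory Limits Set

noncomputable section

set_option linter.unusedSectionVars false

attribute [local instance] Classical.propDecidable

namespace PersistencePaper

theorem rk_eq_ncard (k : Type) [Field k]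
    (M : PersistenceModule k ℤ) (hpfd : Pfd k M)
    (ι : Type) (I : ι → Set ℤ) (hI : ∀ i, (I i).Nonempty ∧ (I i).OrdConnected)
    (iso : M ≅ ∐ fun i => indicator k (I i) (hI i).2)
    (u v : ℤ) (h : u ≤ v) :
    {i | u ∈ I i ∧ v ∈ I i}.Finite ∧ rk k M u v = {i | u ∈ I i ∧ v ∈ I i}.ncard := by
  classical
  let F : ι → PersistenceModule k ℤ := fun i => indicator k (I i) (hI i).2
  let g : ∀ i, F i ⟶ M := fun i => Sigma.ι F i ≫ iso.inv
  let p : ∀ i, M ⟶ F i := fun i =>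
    iso.hom ≫ Sigma.desc (fun j => if hj : j = i then eqToHom (by rw [hj]) else 0)
  have hgp : ∀ i, g i ≫ p i = 𝟙 _ := by 
    intro i
    have h1 := Sigma.ι_desc (f := F)
      (fun j => if hj : j = i then eqToHom (by rw [hj]) else (0 : F j ⟶ F i)) i
    simp only [g, p, Category.assoc, Iso.inv_hom_id_assoc]
    refine Eq.trans h1 ?_
    simp
  have hgp0 : ∀ i j, j ≠ i → g j ≫ p i = 0 := by 
    intro i j hj
    have h1 := Sigma.ι_desc (f := F)
      (fun j => if hj : j = i then eqToHom (by rw [hj]) else (0 : F j ⟶ F i)) j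
    simp only [g, p, Category.assoc, Iso.inv_hom_id_assoc]
    refine Eq.trans h1 ?_
    simp [hj]
  let b : ∀ (i : ι) (w : ℤ), indSub k (I i) w :=
    fun i w => ⟨if w ∈ I i then 1 else 0, fun hw => by simp [hw]⟩
  let e : ∀ (i : ι) (w : ℤ), M.obj w := fun i w => ((g i).app w).hom (b i w)
  have hpe : ∀ i w, ((p i).app w).hom (e i w) = b i w := by
    intro i w
    have := congrArg (fun f => (f.app w).hom (b i w)) (hgp i)
    exact this
  have hpe0 : ∀ i j w, j ≠ i → ((p i).app w).hom (e j w) = 0 := by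
    intro i j w hj
    have := congrArg (fun f => (f.app w).hom (b j w)) (hgp0 i j hj)
    exact this
  have hspan : Submodule.span k (Set.range fun i => e i u) = ⊤ := by
    set S := Submodule.span k (Set.range fun i => e i u)
    have hz : ModuleCat.ofHom S.mkQ = 0 := by
      have hc := isColimitOfPreserves ((evaluation ℤ (ModuleCat k)).obj u)
        (colimit.isColimit (Discrete.functor F))
      have h0 : iso.inv.app u ≫ ModuleCat.ofHom S.mkQ = 0 := by
        apply hc.hom_ext
        rintro ⟨i⟩
        rw [comp_zero]
        refine ModuleCat.hom_ext <| LinearMap.ext fun x => ?_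
        change indSub k (I i) u at x
        have hx : x = (x : k) • b i u := by
          apply Subtype.ext
          by_cases hu : u ∈ I i
          · simp [b, hu]
          · simp [b, hu, x.2 hu]
        change S.mkQ (((g i).app u).hom x) = 0
        have : ((g i).app u).hom x = (x : k) • e i u := by
          conv_lhs => rw [hx]
          exact map_smul _ _ _
        rw [this, Submodule.mkQ_apply, Submodule.Quotient.mk_eq_zero]
        exact S.smul_mem _ (Submodule.subset_span ⟨i, rfl⟩)
      rw [← cancel_epi (iso.inv.app u), h0, comp_zero]
    have hz' : S.mkQ = 0 := congrArg ModuleCat.Hom.hom hz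
    rw [← Submodule.ker_mkQ S, hz', LinearMap.ker_zero]
  have hrho : ∀ i, rho k M h (e i u) = if u ∈ I i ∧ v ∈ I i then e i v else 0 := by
    intro i
    have hn := congrArg (fun f => f.hom (b i u)) ((g i).naturality (homOfLE h))
    have hn' : ((g i).app v).hom (indMap k (I i) u v (b i u)) = rho k M h (e i u) := hn
    rw [← hn']
    split_ifs with hc
    · have : indMap k (I i) u v (b i u) = b i v := by
        apply Subtype.ext; rw [indMap_coe]; simp [b, hc]
      rw [this]
    · have : indMap k (I i) u v (b i u) = 0 := by
        apply Subtype.ext; rw [indMap_coe]; simp [hc]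
      rw [this]
      exact map_zero _
  let A : Set ι := {i | u ∈ I i ∧ v ∈ I i}
  have hli : LinearIndependent k (fun i : A => e i.1 v) := by
    rw [linearIndependent_iff']
    intro s c hs i his
    have := congrArg (((p i.1).app v).hom) hs
    rw [map_sum, map_zero, Finset.sum_eq_single i] at this
    · rw [map_smul, hpe] at this
      have h1 : c i • b i.1 v = 0 := this
      have h2 := congrArg Subtype.val h1
      simpa [b, i.2.2] using h2
    · intro j _ hj
      rw [map_smul, hpe0 _ _ _ (fun hh => hj (Subtype.ext hh)), smul_zero]
    · intro hn; exact absurd his hn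
  have := hpfd v
  have : Finite A := hli.finite
  have : Fintype A := Fintype.ofFinite A
  refine ⟨Set.toFinite A, ?_⟩
  have hr : LinearMap.range (rho k M h) = Submodule.span k (Set.range fun i : A => e i.1 v) := by
    rw [LinearMap.range_eq_map, ← hspan, Submodule.map_span]
    apply le_antisymm
    · rw [Submodule.span_le]
      rintro _ ⟨_, ⟨i, rfl⟩, rfl⟩
      simp only [hrho]
      split_ifs with hc
      · exact Submodule.subset_span ⟨⟨i, hc⟩, rfl⟩
      · exact Submodule.zero_mem _
    · rw [Submodule.span_le]
      rintro _ ⟨⟨i, hi⟩, rfl⟩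
      apply Submodule.subset_span
      refine ⟨_, ⟨i, rfl⟩, ?_⟩
      exact (hrho i).trans (if_pos hi)
  rw [rk, dif_pos h, hr, finrank_span_eq_card hli, ← Nat.card_eq_fintype_card]
  rfl

/-- The persistence-measure inclusion-exclusion formula in one
parameter: the multiplicity of the interval `[s,t]` in an interval decomposition of a
pfd persistence module over `ℤ` is `r(s,t) - r(s-1,t) - r(s,t+1) + r(s-1,t+1)`. -/
theorem interval_multiplicity_eq_inclusion_exclusion (k : Type) [Field k]
    (M : PersistenceModule k ℤ) (hpfd : Pfd k M)
    (ι : Type) (I : ι → Set ℤ) (hI : ∀ i, (I i).Nonempty ∧ (I i).OrdConnected)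
    (iso : M ≅ ∐ fun i => indicator k (I i) (hI i).2)
    (s t : ℤ) (h : s ≤ t) :
    ({i | I i = Set.Icc s t}.ncard : ℤ) =
      (rk k M s t : ℤ) - rk k M (s - 1) t - rk k M s (t + 1) + rk k M (s - 1) (t + 1) := by
  obtain ⟨f1, r1⟩ := rk_eq_ncard k M hpfd ι I hI iso s t h
  obtain ⟨f2, r2⟩ := rk_eq_ncard k M hpfd ι I hI iso (s - 1) t (by omega)
  obtain ⟨f3, r3⟩ := rk_eq_ncard k M hpfd ι I hI iso s (t + 1) (by omega)
  obtain ⟨f4, r4⟩ := rk_eq_ncard k M hpfd ι I hI iso (s - 1) (t + 1) (by omega)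
  rw [r1, r2, r3, r4]
  set A1 := {i | s ∈ I i ∧ t ∈ I i}
  set A2 := {i | s - 1 ∈ I i ∧ t ∈ I i}
  set A3 := {i | s ∈ I i ∧ t + 1 ∈ I i}
  set A4 := {i | s - 1 ∈ I i ∧ t + 1 ∈ I i}
  have oc : ∀ i a b c, a ∈ I i → c ∈ I i → a ≤ b → b ≤ c → b ∈ I i :=
    fun i a b c ha hc h1 h2 => (hI i).2.out ha hc ⟨h1, h2⟩
  have hint : A2 ∩ A3 = A4 := by
    ext i
    constructor
    · rintro ⟨⟨h1, h2⟩, h3, h4⟩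
      exact ⟨h1, h4⟩
    · rintro ⟨h1, h2⟩
      exact ⟨⟨h1, oc i _ _ _ h1 h2 (by omega) (by omega)⟩,
        oc i _ _ _ h1 h2 (by omega) (by omega), h2⟩
  have hsub : A2 ∪ A3 ⊆ A1 := by
    rintro i (⟨h1, h2⟩ | ⟨h1, h2⟩)
    · exact ⟨oc i _ _ _ h1 h2 (by omega) (by omega), h2⟩
    · exact ⟨h1, oc i _ _ _ h1 h2 (by omega) (by omega)⟩
  have hE : {i | I i = Set.Icc s t} = A1 \ (A2 ∪ A3) := by
    ext i
    constructor
    · intro hi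
      have hi' : I i = Set.Icc s t := hi
      refine ⟨⟨?_, ?_⟩, ?_⟩
      · rw [hi']; exact ⟨le_refl _, h⟩
      · rw [hi']; exact ⟨h, le_refl _⟩
      · rintro (⟨h1, _⟩ | ⟨_, h1⟩)
        · rw [hi', Set.mem_Icc] at h1; omega
        · rw [hi', Set.mem_Icc] at h1; omega
    · rintro ⟨⟨h1, h2⟩, h3⟩
      change I i = Set.Icc s t
      ext x
      constructor
      · intro hx
        constructor
        · by_contra hlt
          exact h3 (Or.inl ⟨oc i _ _ _ hx h1 (by omega) (by omega), h2⟩)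
        · by_contra hlt
          exact h3 (Or.inr ⟨h1, oc i _ _ _ h2 hx (by omega) (by omega)⟩)
      · rintro ⟨hx1, hx2⟩
        exact oc i _ _ _ h1 h2 hx1 hx2
  have c1 := Set.ncard_union_add_ncard_inter A2 A3 f2 f3
  have c2 := Set.ncard_sdiff_add_ncard_of_subset hsub f1
  rw [hint] at c1
  rw [hE]
  omega

end PersistencePaper
end
end

section
/- Any direct summand of a weakly exact persistence module over a finite grid X × Y is itself weakly exact: if M ≅ A ⊕ B and M is weakly exact, then A is weakly exact. -/
open CategoryTheory Limits Set

noncomputable section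

set_option linter.unusedSectionVars false

attribute [local instance] Classical.propDecidable

namespace PersistencePaper

theorem exists_retract (k : Type) [Field k] (P : Type) [Preorder P]
    (M A B : PersistenceModule k P) (iso : M ≅ (A ⨿ B : PersistenceModule k P)) :
    ∃ (i : ∀ t, A.obj t →ₗ[k] M.obj t) (r : ∀ t, M.obj t →ₗ[k] A.obj t),
      (∀ t x, r t (i t x) = x) ∧
      (∀ {s t : P} (h : s ≤ t) x, i t (rho k A h x) = rho k M h (i s x)) ∧
      (∀ {s t : P} (h : s ≤ t) x, r t (rho k M h x) = rho k A h (r s x)) := by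
  let i : A ⟶ M := coprod.inl ≫ iso.inv
  let r : M ⟶ A := iso.hom ≫ coprod.desc (𝟙 A) 0
  have hir : i ≫ r = 𝟙 A := by
    simp only [i, r, Category.assoc, Iso.inv_hom_id_assoc]
    exact coprod.inl_desc _ _
  refine ⟨fun t => (i.app t).hom, fun t => (r.app t).hom, ?_, ?_, ?_⟩
  · intro t x
    have h : i.app t ≫ r.app t = 𝟙 _ := by rw [← NatTrans.comp_app, hir, NatTrans.id_app]
    exact congrArg (fun f => ModuleCat.Hom.hom f x) h
  · intro s t h x
    exact congrArg (fun f => ModuleCat.Hom.hom f x) (i.naturality (homOfLE h))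
  · intro s t h x
    exact congrArg (fun f => ModuleCat.Hom.hom f x) (r.naturality (homOfLE h))

theorem rho_rho_s10 (k : Type) [Field k] (P : Type) [Preorder P]
    (A : PersistenceModule k P) {s u t : P} (h : s ≤ u) (h' : u ≤ t) (x : A.obj s) :
    rho k A h' (rho k A h x) = rho k A (h.trans h') x :=
  (congrArg (fun f => ModuleCat.Hom.hom f x) (A.map_comp (homOfLE h) (homOfLE h'))).symm

/-- Any direct summand of a weakly exact persistence module over a
finite grid is weakly exact. -/
theorem summand_weaklyExact (k : Type) [Field k]
    (X Y : Type) [LinearOrder X] [LinearOrder Y] [Fintype X] [Fintype Y]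
    (M A B : PersistenceModule k (X × Y))
    (iso : M ≅ (A ⨿ B : PersistenceModule k (X × Y)))
    (hM : WeaklyExact k M) :
    WeaklyExact k A := by
  obtain ⟨i, r, hid, hi, hr⟩ := exists_retract k (X × Y) M A B iso
  intro s t h
  have h1 : s ≤ (t.1, s.2) := ⟨h.1, le_refl s.2⟩
  have h2 : s ≤ (s.1, t.2) := ⟨le_refl s.1, h.2⟩
  have h3 : (t.1, s.2) ≤ t := ⟨le_refl t.1, h.2⟩
  have h4 : (s.1, t.2) ≤ t := ⟨h.1, le_refl t.2⟩
  obtain ⟨hI, hK⟩ := hM s t h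
  constructor
  · apply le_antisymm
    · rintro _ ⟨x, rfl⟩
      exact ⟨⟨rho k A h1 x, rho_rho_s10 k _ A h1 h3 x⟩, ⟨rho k A h2 x, rho_rho_s10 k _ A h2 h4 x⟩⟩
    · rintro y ⟨⟨a, ha⟩, ⟨b, hb⟩⟩
      have hy : i t y ∈ LinearMap.range (rho k M h) := by
        rw [hI]
        exact ⟨⟨i _ a, by rw [← hi, ha]⟩, ⟨i _ b, by rw [← hi, hb]⟩⟩
      obtain ⟨m, hm⟩ := hy
      exact ⟨r s m, by rw [← hr, hm, hid]⟩
  · apply le_antisymm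
    · intro x hx
      rw [LinearMap.mem_ker] at hx
      have hy : i s x ∈ LinearMap.ker (rho k M h) := by
        rw [LinearMap.mem_ker, ← hi, hx, map_zero]
      rw [hK] at hy
      obtain ⟨a, ha, b, hb, hab⟩ := Submodule.mem_sup.1 hy
      rw [LinearMap.mem_ker] at ha hb
      refine Submodule.mem_sup.2 ⟨r s a, ?_, r s b, ?_, ?_⟩
      · rw [LinearMap.mem_ker, ← hr, ha, map_zero]
      · rw [LinearMap.mem_ker, ← hr, hb, map_zero]
      · rw [← map_add, hab, hid]
    · refine sup_le ?_ ?_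
      · intro x hx
        rw [LinearMap.mem_ker] at hx ⊢
        rw [← rho_rho_s10 k _ A h1 h3, hx, map_zero]
      · intro x hx
        rw [LinearMap.mem_ker] at hx ⊢
        rw [← rho_rho_s10 k _ A h2 h4, hx, map_zero]

end PersistencePaper
end
end

section
/- Let n ≥ 2. The persistence module V_n over the poset D_n satisfies: (1) the endomorphism ring of V_n is isomorphic to k (in particular it is local, and V_n is indecomposable); (2) for every i ∈ {1, …, n+1}, the restriction of V_n to D_n ∖ {i} is isomorphic to the direct sum over j ∈ {1, …, n+1} ∖ {i} of the indicator modules k_{{j, n+2}}. -/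
open CategoryTheory Limits Set

noncomputable section

set_option linter.unusedSectionVars false

attribute [local instance] Classical.propDecidable

namespace PersistencePaper

/-- The poset `D_n`: the elements `0, …, n` of `Fin (n+2)` (representing `1, …, n+1`) are
pairwise-incomparable minimal elements, all lying below the single maximal element
`Fin.last (n+1)` (representing `n+2`). -/
def DPos (n : ℕ) : Type := Fin (n + 2)

instance (n : ℕ) : PartialOrder (DPos n) where
  le i j := i = j ∨ j = Fin.last (n + 1)
  le_refl i := Or.inl rfl
  le_trans i j l h1 h2 := by
    rcases h1 with rfl | h1
    · exact h2
    · rcases h2 with rfl | h2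
      · exact Or.inr h1
      · exact Or.inr h2
  le_antisymm i j h1 h2 := by
    rcases h1 with rfl | h1
    · rfl
    · rcases h2 with rfl | h2
      · rfl
      · exact h2.trans h1.symm

theorem DPos.le_def {n : ℕ} (i j : DPos n) : i ≤ j ↔ i = j ∨ j = Fin.last (n + 1) :=
  Iff.rfl

/-- The space of the module `V_n` at the vertex `i` of `D_n`, realized as a submodule of
`k^n`: the `i`-th coordinate axis `k·eᵢ` for each of the first `n` minimal vertices, the
diagonal line `k·(1,…,1)` for the last minimal vertex, and all of `k^n` at the maximal
vertex.  The structure maps of `V_n` are the inclusions, i.e. the inclusions `ιᵢ` of the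
coordinate axes and the diagonal embedding `δ_n`. -/
def Vsub (k : Type) [Field k] (n : ℕ) (i : DPos n) : Submodule k (Fin n → k) :=
  if i = Fin.last (n + 1) then ⊤
  else if h : (i : Fin (n + 2)).1 < n then
    Submodule.span k {Pi.single (⟨(i : Fin (n + 2)).1, h⟩ : Fin n) (1 : k)}
  else Submodule.span k {(fun _ => 1 : Fin n → k)}

theorem Vsub_mono (k : Type) [Field k] (n : ℕ) {i j : DPos n} (h : i ≤ j) :
    Vsub k n i ≤ Vsub k n j := by
  rcases (DPos.le_def i j).mp h with rfl | h
  · exact le_rfl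
  · have ht : Vsub k n j = ⊤ := by rw [Vsub, if_pos h]
    rw [ht]
    exact le_top

/-- The persistence module `V_n` over `D_n`. -/
def Vmod (k : Type) [Field k] (n : ℕ) : PersistenceModule k (DPos n) where
  obj i := ModuleCat.of k (Vsub k n i)
  map {i j} f := ModuleCat.ofHom (Submodule.inclusion (Vsub_mono k n (leOfHom f)))
  map_id _ := rfl
  map_comp _ _ := rfl

/-- generating vectors -/
def vvec (k : Type) [Field k] (n : ℕ) (j : DPos n) : Fin n → k :=
  if h : (j : Fin (n + 2)).1 < n then Pi.single (⟨(j : Fin (n + 2)).1, h⟩ : Fin n) (1 : k)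
  else fun _ => 1

theorem Vsub_last (k : Type) [Field k] (n : ℕ) {j : DPos n} (h : j = Fin.last (n + 1)) :
    Vsub k n j = ⊤ := by rw [Vsub, if_pos h]

theorem Vsub_eq (k : Type) [Field k] (n : ℕ) {j : DPos n} (h : j ≠ Fin.last (n + 1)) :
    Vsub k n j = Submodule.span k {vvec k n j} := by
  rw [Vsub, if_neg h, vvec]
  split_ifs <;> rfl

/-- the low vertices -/
def lowv (n : ℕ) (m : Fin n) : DPos n := (⟨m.1, by omega⟩ : Fin (n + 2))

/-- the diagonal vertex -/
def diagv (n : ℕ) : DPos n := (⟨n, by omega⟩ : Fin (n + 2))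

theorem lowv_ne (n : ℕ) (m : Fin n) : lowv n m ≠ Fin.last (n + 1) := by
  intro h
  have := congrArg (fun x : Fin (n+2) => x.1) h
  simp [lowv] at this
  omega

theorem diagv_ne (n : ℕ) : diagv n ≠ Fin.last (n + 1) := by
  intro h
  have := congrArg (fun x : Fin (n+2) => x.1) h
  simp [diagv] at this

theorem vvec_lowv (k : Type) [Field k] (n : ℕ) (m : Fin n) :
    vvec k n (lowv n m) = Pi.single m 1 := by
  rw [vvec, dif_pos (show (lowv n m : Fin (n+2)).1 < n from m.2)]
  rfl

theorem vvec_diagv (k : Type) [Field k] (n : ℕ) :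
    vvec k n (diagv n) = fun _ => 1 := by
  rw [vvec, dif_neg (show ¬ (diagv n : Fin (n+2)).1 < n from lt_irrefl n)]

theorem sum_vvec (k : Type) [Field k] (n : ℕ) :
    ∑ m : Fin n, vvec k n (lowv n m) = vvec k n (diagv n) := by
  simp_rw [vvec_lowv, vvec_diagv]
  ext a
  simp [Finset.sum_apply, Pi.single_apply]

theorem cases_v (n : ℕ) (j : DPos n) (hj : j ≠ Fin.last (n + 1)) :
    (∃ m, j = lowv n m) ∨ j = diagv n := by
  have h1 : (j : Fin (n+2)).1 ≠ n + 1 := fun h => hj (Fin.ext h)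
  have h2 : (j : Fin (n+2)).1 < n + 2 := (j : Fin (n+2)).2
  by_cases h : (j : Fin (n+2)).1 < n
  · exact Or.inl ⟨⟨_, h⟩, rfl⟩
  · right
    apply Fin.ext
    show (j : Fin (n+2)).1 = n
    omega

theorem lin_scalar (k : Type) [Field k] (n : ℕ) (hn : 2 ≤ n)
    (F : (Fin n → k) →ₗ[k] (Fin n → k))
    (hF : ∀ j : DPos n, j ≠ Fin.last (n + 1) → F (vvec k n j) ∈ Submodule.span k {vvec k n j}) :
    ∃ c : k, ∀ v, F v = c • v := by
  simp_rw [Submodule.mem_span_singleton] at hF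
  choose! c hc using hF
  refine ⟨c (diagv n), fun v => ?_⟩
  have h1 : ∀ m, c (lowv n m) = c (diagv n) := by
    intro m
    have h := hc _ (diagv_ne n)
    rw [← sum_vvec, map_sum] at h
    simp_rw [← fun m => hc _ (lowv_ne n m)] at h
    rw [sum_vvec] at h
    have := congrFun h m
    simp only [vvec_diagv, vvec_lowv] at this
    simpa [Finset.sum_apply, Pi.single_apply] using this.symm
  have : F = c (diagv n) • LinearMap.id := by
    apply LinearMap.pi_ext'
    intro m
    ext1
    have := hc _ (lowv_ne n m)
    rw [h1, vvec_lowv] at this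
    simpa using this.symm
  rw [this]; rfl

theorem part1 (k : Type) [Field k] (n : ℕ) (hn : 2 ≤ n) :
    Nonempty (End (Vmod k n) ≃+* k) := by
  have hs : ∀ f : End (Vmod k n), ∃ c : k, ∀ (j : DPos n) (x : Vsub k n j),
      (show Vsub k n j from ((f : Vmod k n ⟶ Vmod k n).app j).hom x).1 = c • x.1 := by
    intro f
    let L : DPos n := Fin.last (n + 1)
    have hL : ∀ v, v ∈ Vsub k n L := fun v => by rw [Vsub_last k n rfl]; trivial
    let F : (Fin n → k) →ₗ[k] (Fin n → k) :=
      (Vsub k n L).subtype ∘ₗ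
        (show Vsub k n L →ₗ[k] Vsub k n L from ((f : Vmod k n ⟶ Vmod k n).app L).hom) ∘ₗ
        LinearMap.codRestrict (Vsub k n L) LinearMap.id hL
    have key : ∀ (j : DPos n) (x : Vsub k n j),
      (show Vsub k n j from ((f : Vmod k n ⟶ Vmod k n).app j).hom x).1 = F x.1 := by
      intro j x
      have hle : j ≤ L := Or.inr rfl
      have h := (f : Vmod k n ⟶ Vmod k n).naturality (homOfLE hle)
      have h2 := congrArg (fun g => ModuleCat.Hom.hom g x) h
      exact (congrArg (fun y : Vsub k n L => y.1) h2).symm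
    obtain ⟨c, hc⟩ := lin_scalar k n hn F (by
      intro j hj
      have hm : vvec k n j ∈ Vsub k n j := by
        rw [Vsub_eq k n hj]; exact Submodule.mem_span_singleton_self _
      have h := key j ⟨_, hm⟩
      rw [← h, ← Vsub_eq k n hj]
      exact Subtype.property _)
    exact ⟨c, fun j x => by rw [key, hc]⟩
  refine ⟨(RingEquiv.ofBijective (algebraMap k (End (Vmod k n))) ⟨?_, ?_⟩).symm⟩
  · intro a b hab
    have h : a • 𝟙 (Vmod k n) = b • 𝟙 (Vmod k n) := by
      simpa [Algebra.algebraMap_eq_smul_one] using hab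
    let j := diagv n
    have hm : vvec k n j ∈ Vsub k n j := by
      rw [Vsub_eq k n (diagv_ne n)]; exact Submodule.mem_span_singleton_self _
    have h2 := congrArg (fun g : Vmod k n ⟶ Vmod k n => (g.app j).hom ⟨_, hm⟩) h
    have h3 : a • vvec k n j = b • vvec k n j := congrArg (fun y : Vsub k n j => y.1) h2
    have h4 := congrFun h3 ⟨0, by omega⟩
    simpa [j, vvec_diagv] using h4
  · intro f
    obtain ⟨c, hc⟩ := hs f
    refine ⟨c, ?_⟩
    rw [Algebra.algebraMap_eq_smul_one]
    refine NatTrans.ext (funext fun j => ModuleCat.hom_ext (LinearMap.ext fun x => Subtype.ext ?_))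
    exact (hc j x).symm

theorem span_aux (k : Type) [Field k] (n : ℕ) (i : DPos n) (hi : i ≠ Fin.last (n + 1)) :
    ⊤ ≤ Submodule.span k (Set.range
      fun j : {j : DPos n // j ≠ i ∧ j ≠ Fin.last (n + 1)} => vvec k n j.1) := by
  set S := Submodule.span k (Set.range
      fun j : {j : DPos n // j ≠ i ∧ j ≠ Fin.last (n + 1)} => vvec k n j.1) with hS
  have h0 : ∀ j : DPos n, j ≠ i → j ≠ Fin.last (n + 1) → vvec k n j ∈ S := fun j h h' =>
    Submodule.subset_span ⟨⟨j, h, h'⟩, rfl⟩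
  have h1 : ∀ m, vvec k n (lowv n m) ∈ S := by
    intro m
    by_cases hm : lowv n m = i
    · have hd : vvec k n (diagv n) ∈ S := by
        refine h0 _ ?_ (diagv_ne n)
        rw [← hm]
        intro h
        have := congrArg (fun x : Fin (n+2) => x.1) h
        simp [lowv, diagv] at this
        omega
      rw [← sum_vvec, ← Finset.add_sum_erase _ _ (Finset.mem_univ m)] at hd
      refine (Submodule.add_mem_iff_left _ (Submodule.sum_mem _ ?_)).1 hd
      intro m' hm'
      refine h0 _ ?_ (lowv_ne n m')
      rw [← hm]
      intro h
      have := congrArg (fun x : Fin (n+2) => x.1) h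
      simp only [lowv] at this
      exact (Finset.mem_erase.1 hm').1 (Fin.ext this)
    · exact h0 _ hm (lowv_ne n m)
  intro v _
  rw [pi_eq_sum_univ' v]
  refine Submodule.sum_mem _ fun m _ => ?_
  have := S.smul_mem (v m) (h1 m)
  rw [vvec_lowv] at this
  convert this using 2

instance (n : ℕ) : Fintype (DPos n) := inferInstanceAs (Fintype (Fin (n + 2)))

theorem card_aux (n : ℕ) (i : DPos n) (hi : i ≠ Fin.last (n + 1)) :
    Fintype.card {j : DPos n // j ≠ i ∧ j ≠ Fin.last (n + 1)} = n := by
  obtain ⟨L, hL⟩ : ∃ L : DPos n, L = Fin.last (n + 1) := ⟨_, rfl⟩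
  have hL' : i ≠ L := fun h => hi (h.trans hL)
  suffices Fintype.card {j : DPos n // j ≠ i ∧ j ≠ L} = n by subst hL; exact this
  rw [Fintype.card_subtype]
  have : (Finset.univ.filter fun j : DPos n => j ≠ i ∧ j ≠ L) =
      (Finset.univ.erase L).erase i := by
    ext j; simp
  rw [this, Finset.card_erase_of_mem (by simp [hL']), Finset.card_erase_of_mem (by simp)]
  have : (Finset.univ : Finset (DPos n)).card = n + 2 := Fintype.card_fin (n + 2)
  omega

/-- The basis. -/
def vbasis (k : Type) [Field k] (n : ℕ) (i : DPos n) (hi : i ≠ Fin.last (n + 1)) :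
    Module.Basis {j : DPos n // j ≠ i ∧ j ≠ Fin.last (n + 1)} k (Fin n → k) :=
  basisOfTopLeSpanOfCardEqFinrank _ (span_aux k n i hi) (by rw [card_aux n i hi]; simp)

theorem vbasis_apply (k : Type) [Field k] (n : ℕ) (i : DPos n) (hi : i ≠ Fin.last (n + 1)) (j) :
    vbasis k n i hi j = vvec k n j.1 := by simp [vbasis]

theorem conv_aux (n : ℕ) (i : DPos n) (j : {j : DPos n // j ≠ i ∧ j ≠ Fin.last (n + 1)}) :
    Set.OrdConnected {x : ↥{x : DPos n | x ≠ i} | x.1 = j.1 ∨ x.1 = Fin.last (n + 1)} := by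
  constructor
  intro x hx y hy z hz
  rcases (DPos.le_def x.1 z.1).1 hz.1 with h | h
  · have : z = x := Subtype.ext h.symm
    rw [this]; exact hx
  · exact Or.inr h

/-- support -/
abbrev Qs (n : ℕ) (i : DPos n) (j : {j : DPos n // j ≠ i ∧ j ≠ Fin.last (n + 1)}) :
    Set ↥{x : DPos n | x ≠ i} := {x | x.1 = j.1 ∨ x.1 = Fin.last (n + 1)}

/-- fiberwise inclusion -/
def phiL (k : Type) [Field k] (n : ℕ) (i : DPos n)
    (j : {j : DPos n // j ≠ i ∧ j ≠ Fin.last (n + 1)}) (x : ↥{x : DPos n | x ≠ i}) :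
    indSub k (Qs n i j) x →ₗ[k] Vsub k n x.1 :=
  LinearMap.codRestrict _ ((LinearMap.toSpanSingleton k _ (vvec k n j.1)) ∘ₗ Submodule.subtype _)
  (by
    intro a
    show a.1 • vvec k n j.1 ∈ _
    by_cases hx : x ∈ Qs n i j
    · rcases hx with h | h
      · rw [h, Vsub_eq k n j.2.2]
        exact Submodule.smul_mem _ _ (Submodule.mem_span_singleton_self _)
      · rw [Vsub_last k n h]; trivial
    · rw [a.2 hx, zero_smul]; exact zero_mem _)

theorem phiL_coe (k : Type) [Field k] (n : ℕ) (i : DPos n) (j x) (a) :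
    (phiL k n i j x a).1 = a.1 • vvec k n j.1 := rfl

/-- fiberwise coordinate -/
def psiL (k : Type) [Field k] (n : ℕ) (i : DPos n) (hi : i ≠ Fin.last (n + 1))
    (j : {j : DPos n // j ≠ i ∧ j ≠ Fin.last (n + 1)}) (x : ↥{x : DPos n | x ≠ i}) :
    Vsub k n x.1 →ₗ[k] indSub k (Qs n i j) x :=
  LinearMap.codRestrict _ ((vbasis k n i hi).coord j ∘ₗ Submodule.subtype _)
  (by
    intro v hx
    have h1 : x.1 ≠ j.1 := fun h => hx (Or.inl h)
    have h2 : x.1 ≠ Fin.last (n + 1) := fun h => hx (Or.inr h)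
    have hv : v.1 ∈ Submodule.span k {vvec k n x.1} := (Vsub_eq k n h2).le v.2
    rw [Submodule.mem_span_singleton] at hv
    obtain ⟨c, hc⟩ := hv
    show (vbasis k n i hi).coord j v.1 = 0
    rw [← hc, ← vbasis_apply k n i hi ⟨x.1, x.2, h2⟩, map_smul, Module.Basis.coord_apply,
      Module.Basis.repr_self, Finsupp.single_eq_of_ne, smul_zero]
    intro h
    exact h1 (congrArg Subtype.val h).symm)

theorem psiL_coe (k : Type) [Field k] (n : ℕ) (i : DPos n) (hi) (j x) (a) :
    (psiL k n i hi j x a).1 = (vbasis k n i hi).coord j a.1 := rfl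

theorem Qs_up (n : ℕ) (i : DPos n) (j) {x y : ↥{x : DPos n | x ≠ i}} (h : x ≤ y)
    (hx : x ∈ Qs n i j) : y ∈ Qs n i j := by
  rcases (DPos.le_def x.1 y.1).1 h with h | h
  · have : y = x := Subtype.ext h.symm
    rw [this]; exact hx
  · exact Or.inr h

theorem phi_nat (k : Type) [Field k] (n : ℕ) (i : DPos n) (j) {x y : ↥{x : DPos n | x ≠ i}}
    (hxy : x ≤ y) (a : indSub k (Qs n i j) x) :
    (phiL k n i j y (indMap k (Qs n i j) x y a)).1 = (phiL k n i j x a).1 := by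
  rw [phiL_coe, phiL_coe, indMap_coe]
  split_ifs with h
  · rfl
  · rw [a.2 fun hx => h ⟨hx, Qs_up n i j hxy hx⟩]

theorem psi_phi_val (k : Type) [Field k] (n : ℕ) (i : DPos n) (hi) (j j')
    (x : ↥{x : DPos n | x ≠ i}) (a : indSub k (Qs n i j) x) :
    (psiL k n i hi j' x (phiL k n i j x a)).1 = if j = j' then a.1 else 0 := by
  rw [psiL_coe, phiL_coe, ← vbasis_apply k n i hi j, map_smul, Module.Basis.coord_apply,
      Module.Basis.repr_self, Finsupp.single_apply]
  split_ifs <;> simp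

/-- inclusion -/
def phiN (k : Type) [Field k] (n : ℕ) (i : DPos n)
    (j : {j : DPos n // j ≠ i ∧ j ≠ Fin.last (n + 1)}) :
    indicator k (Qs n i j) (conv_aux n i j) ⟶ restrict k (Vmod k n) {x : DPos n | x ≠ i} where
  app x := ModuleCat.ofHom (phiL k n i j x)
  naturality x y f := by
    refine ModuleCat.hom_ext <| LinearMap.ext fun a => Subtype.ext ?_
    exact phi_nat k n i j (leOfHom f) a

/-- coordinate -/
def psiN (k : Type) [Field k] (n : ℕ) (i : DPos n) (hi : i ≠ Fin.last (n + 1))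
    (j : {j : DPos n // j ≠ i ∧ j ≠ Fin.last (n + 1)}) :
    restrict k (Vmod k n) {x : DPos n | x ≠ i} ⟶ indicator k (Qs n i j) (conv_aux n i j) where
  app x := ModuleCat.ofHom (psiL k n i hi j x)
  naturality x y f := by
    refine ModuleCat.hom_ext <| LinearMap.ext fun a => Subtype.ext ?_
    show (psiL k n i hi j y (Submodule.inclusion (Vsub_mono k n (leOfHom f)) a)).1 =
      (indMap k (Qs n i j) x y (psiL k n i hi j x a)).1
    rw [indMap_coe]
    split_ifs with h
    · rfl
    · have : (psiL k n i hi j x a).1 = 0 :=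
        (psiL k n i hi j x a).2 fun hx => h ⟨hx, Qs_up n i j (leOfHom f) hx⟩
      exact this

theorem phi_psi_self (k : Type) [Field k] (n : ℕ) (i : DPos n) (hi) (j) :
    phiN k n i j ≫ psiN k n i hi j = 𝟙 _ := by
  refine NatTrans.ext (funext fun x => ModuleCat.hom_ext (LinearMap.ext fun a => Subtype.ext ?_))
  show (psiL k n i hi j x (phiL k n i j x a)).1 = Subtype.val a
  exact (psi_phi_val k n i hi j j x a).trans (if_pos rfl)

theorem phi_psi_ne (k : Type) [Field k] (n : ℕ) (i : DPos n) (hi) (j j') (h : j ≠ j') :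
    phiN k n i j ≫ psiN k n i hi j' = 0 := by
  refine NatTrans.ext (funext fun x => ModuleCat.hom_ext (LinearMap.ext fun a => Subtype.ext ?_))
  show (psiL k n i hi j' x (phiL k n i j x a)).1 = 0
  exact (psi_phi_val k n i hi j j' x a).trans (if_neg h)

theorem psi_phi_sum (k : Type) [Field k] (n : ℕ) (i : DPos n) (hi) :
    ∑ j, psiN k n i hi j ≫ phiN k n i j = 𝟙 _ := by
  refine NatTrans.ext (funext fun x => ModuleCat.hom_ext (LinearMap.ext fun a => Subtype.ext ?_))
  rw [NatTrans.app_sum, ModuleCat.hom_sum, LinearMap.sum_apply]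
  have h1 : ∀ f : {j : DPos n // j ≠ i ∧ j ≠ Fin.last (n + 1)} → Vsub k n x.1,
    (∑ j, f j : Vsub k n x.1).1 = ∑ j, (f j).1 := fun f => by simp
  refine (h1 _).trans ?_
  refine Eq.trans ?_ ((vbasis k n i hi).sum_repr (Subtype.val a))
  refine Finset.sum_congr rfl fun j _ => ?_
  rw [vbasis_apply]
  rfl

/-- (1) The endomorphism ring of `V_n` is isomorphic to `k`
(in particular it is local and `V_n` is indecomposable); (2) for every minimal vertex
`i` of `D_n`, the restriction of `V_n` to `D_n ∖ {i}` decomposes as the direct sum, over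
the minimal vertices `j ∉ {i}`, of the indicator modules of the two-point sets
`{j, n+2}`. -/
theorem Vmod_end_ring_and_restriction_decomposition (k : Type) [Field k]
    (n : ℕ) (hn : 2 ≤ n) :
    Nonempty (End (Vmod k n) ≃+* k) ∧
      ∀ i : DPos n, i ≠ Fin.last (n + 1) →
        ∃ hconv : ∀ j : {j : DPos n // j ≠ i ∧ j ≠ Fin.last (n + 1)},
            Set.OrdConnected
              {x : ↥{x : DPos n | x ≠ i} | x.1 = j.1 ∨ x.1 = Fin.last (n + 1)},
          Nonempty
            (restrict k (Vmod k n) {x : DPos n | x ≠ i} ≅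
              ∐ fun j : {j : DPos n // j ≠ i ∧ j ≠ Fin.last (n + 1)} =>
                indicator k
                  {x : ↥{x : DPos n | x ≠ i} | x.1 = j.1 ∨ x.1 = Fin.last (n + 1)}
                  (hconv j)) := by
  refine ⟨part1 k n hn, fun i hi => ⟨conv_aux n i, ⟨⟨
    ∑ j, psiN k n i hi j ≫ Sigma.ι
      (fun j => indicator k (Qs n i j) (conv_aux n i j)) j,
    Sigma.desc fun j => phiN k n i j, ?_, ?_⟩⟩⟩⟩
  · rw [Preadditive.sum_comp]
    simp_rw [Category.assoc, Sigma.ι_desc]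
    exact psi_phi_sum k n i hi
  · refine Sigma.hom_ext _ _ fun j => ?_
    rw [Sigma.ι_desc_assoc, Preadditive.comp_sum, Finset.sum_eq_single j]
    · rw [← Category.assoc, phi_psi_self, Category.id_comp, Category.comp_id]
    · intro j' _ h
      rw [← Category.assoc, phi_psi_ne k n i hi j j' h.symm, zero_comp]
    · intro h; exact absurd (Finset.mem_univ j) h

end PersistencePaper
end
end
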